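/- arXiv:1912.08796 — 10 statements merged into one kernel-verified Lean document; each statement's English description precedes it below -/
import Mathlib

section
/- Let α, β₁, β₂ ∈ (0,1], let f : ℝ² → ℝ be α-Hölder and let gⁱ : ℝ² → ℝ be βᵢ-Hölder for i = 1, 2. Then for all p, q, r, s ∈ ℝ² one has |(δ ito)_{pqrs}| ≤ [f]_α·[g¹]_{β₁}·[g²]_{β₂}·diam([pqrs])^{α+β₁+β₂}. -/
open Filter Metric

noncomputable section

/-- The plane `ℝ²`. -/
abbrev E2 : Type := EuclideanSpace ℝ (Fin 2)

/-- The Stratonovich germ of `(f, g¹, g²)`. -/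
def strat (f g1 g2 : E2 → ℝ) (p q r : E2) : ℝ :=
  (1/2) * ((f p + f q + f r)/3) *
    ((g1 q - g1 p) * (g2 r - g2 p) - (g1 r - g1 p) * (g2 q - g2 p))

/-- The Itô germ of `(f, g¹, g²)`. -/
def ito (f g1 g2 : E2 → ℝ) (p q r : E2) : ℝ :=
  (1/2) * f p *
    ((g1 q - g1 p) * (g2 r - g2 p) - (g1 r - g1 p) * (g2 q - g2 p))

/-- Coboundary of a 2-germ. -/
def cob (ω : E2 → E2 → E2 → ℝ) (p q r s : E2) : ℝ :=
  ω q r s - ω p r s + ω p q s - ω p q r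

/-- Dyadic sums `ω^n` of a 2-germ `ω`. -/
def dyaSum (ω : E2 → E2 → E2 → ℝ) : ℕ → E2 → E2 → E2 → ℝ
  | 0 => ω
  | n + 1 => fun p0 p1 p2 =>
      dyaSum ω n (midpoint ℝ p1 p2) (midpoint ℝ p0 p2) (midpoint ℝ p0 p1)
      + dyaSum ω n (midpoint ℝ p0 p2) (midpoint ℝ p1 p2) p2
      + dyaSum ω n (midpoint ℝ p0 p1) p1 (midpoint ℝ p1 p2)
      + dyaSum ω n p0 (midpoint ℝ p0 p1) (midpoint ℝ p0 p2)

/-- Side correctors `S^n` of a 2-germ `ω`. -/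
def sideCorr (ω : E2 → E2 → E2 → ℝ) : ℕ → E2 → E2 → ℝ
  | 0 => fun _ _ => 0
  | n + 1 => fun p q =>
      ω p (midpoint ℝ p q) q + sideCorr ω n p (midpoint ℝ p q)
        + sideCorr ω n (midpoint ℝ p q) q

/-- A 2-germ is alternating if it changes sign according to the sign of permutations
of its three arguments. -/
def Alternating2 (ω : E2 → E2 → E2 → ℝ) : Prop :=
  ∀ (σ : Equiv.Perm (Fin 3)) (p : Fin 3 → E2),
    ω (p (σ 0)) (p (σ 1)) (p (σ 2)) = ((Equiv.Perm.sign σ : ℤ) : ℝ) * ω (p 0) (p 1) (p 2)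


/-- `|(δ ito)_{pqrs}| ≤ [f]_α·[g¹]_{β₁}·[g²]_{β₂}·diam([pqrs])^{α+β₁+β₂}`. -/
theorem stmt_4 (α β₁ β₂ : ℝ) (hα : α ∈ Set.Ioc (0:ℝ) 1) (hβ₁ : β₁ ∈ Set.Ioc (0:ℝ) 1)
    (hβ₂ : β₂ ∈ Set.Ioc (0:ℝ) 1)
    (f g1 g2 : E2 → ℝ) (Hf H1 H2 : ℝ) (hHf0 : 0 ≤ Hf) (hH10 : 0 ≤ H1) (hH20 : 0 ≤ H2)
    (hf : ∀ x y, |f x - f y| ≤ Hf * dist x y ^ α)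
    (hg1 : ∀ x y, |g1 x - g1 y| ≤ H1 * dist x y ^ β₁)
    (hg2 : ∀ x y, |g2 x - g2 y| ≤ H2 * dist x y ^ β₂)
    (p q r s : E2) :
    |cob (ito f g1 g2) p q r s| ≤
      Hf * H1 * H2 * Metric.diam ({p, q, r, s} : Set E2) ^ (α + β₁ + β₂) := by
  set d := Metric.diam ({p, q, r, s} : Set E2)
  have hd0 : 0 ≤ d := Metric.diam_nonneg
  have hbdd : Bornology.IsBounded ({p, q, r, s} : Set E2) := (Set.toFinite _).isBounded
  have holder_diam {h : E2 → ℝ} {H γ : ℝ} (hH : 0 ≤ H) (hγ : γ ∈ Set.Ioc (0 : ℝ) 1)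
      (hh : ∀ x y, |h x - h y| ≤ H * dist x y ^ γ) {x y : E2}
      (hx : x ∈ ({p, q, r, s} : Set E2)) (hy : y ∈ ({p, q, r, s} : Set E2)) :
      |h x - h y| ≤ H * d ^ γ :=
    (hh x y).trans (mul_le_mul_of_nonneg_left
      (Real.rpow_le_rpow dist_nonneg (Metric.dist_le_diam_of_mem hbdd hx hy) hγ.1.le) hH)
  have hF : |f q - f p| ≤ Hf * d ^ α := holder_diam hHf0 hα hf (by simp) (by simp)
  have h1r : |g1 r - g1 q| ≤ H1 * d ^ β₁ := holder_diam hH10 hβ₁ hg1 (by simp) (by simp)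
  have h1s : |g1 s - g1 q| ≤ H1 * d ^ β₁ := holder_diam hH10 hβ₁ hg1 (by simp) (by simp)
  have h2r : |g2 r - g2 q| ≤ H2 * d ^ β₂ := holder_diam hH20 hβ₂ hg2 (by simp) (by simp)
  have h2s : |g2 s - g2 q| ≤ H2 * d ^ β₂ := holder_diam hH20 hβ₂ hg2 (by simp) (by simp)
  have hcob : cob (ito f g1 g2) p q r s = (1/2) * ((f q - f p) *
      ((g1 r - g1 q) * (g2 s - g2 q) - (g1 s - g1 q) * (g2 r - g2 q))) := by
    simp only [cob, ito]
    ring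
  have hpow : d ^ (α + β₁ + β₂) = d ^ α * d ^ β₁ * d ^ β₂ := by
    rw [Real.rpow_add_of_nonneg hd0 (add_nonneg hα.1.le hβ₁.1.le) hβ₂.1.le,
      Real.rpow_add_of_nonneg hd0 hα.1.le hβ₁.1.le]
  have harea : |(g1 r - g1 q) * (g2 s - g2 q) - (g1 s - g1 q) * (g2 r - g2 q)| ≤
      2 * ((H1 * d ^ β₁) * (H2 * d ^ β₂)) := by
    refine (abs_sub _ _).trans ?_
    rw [abs_mul, abs_mul, two_mul]
    gcongr
  rw [hcob, hpow, abs_mul, abs_mul, abs_of_pos (by norm_num : (0 : ℝ) < 1 / 2)]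
  calc (1 / 2) * (|f q - f p| *
        |(g1 r - g1 q) * (g2 s - g2 q) - (g1 s - g1 q) * (g2 r - g2 q)|)
      ≤ (1 / 2) * ((Hf * d ^ α) * (2 * ((H1 * d ^ β₁) * (H2 * d ^ β₂)))) := by gcongr
    _ = Hf * H1 * H2 * (d ^ α * d ^ β₁ * d ^ β₂) := by ring
end
end

section
/- Let α, β₁, β₂ ∈ (0,1], let f : ℝ² → ℝ be α-Hölder and let gⁱ : ℝ² → ℝ be βᵢ-Hölder for i = 1, 2. Then for all p, q, r, s ∈ ℝ² one has |(δ strat)_{pqrs}| ≤ 8·[f]_α·[g¹]_{β₁}·[g²]_{β₂}·diam([pqrs])^{α+β₁+β₂}. -/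
open Filter Metric

noncomputable section

/-- The coboundary of the Stratonovich germ only involves increments of `f`. -/
theorem cob_strat_eq (f g1 g2 : E2 → ℝ) (p q r s : E2) :
    cob (strat f g1 g2) p q r s =
      (1/6) * ((f q - f p) * ((g1 r - g1 p) * (g2 s - g2 p) - (g1 s - g1 p) * (g2 r - g2 p))
        - (f r - f p) * ((g1 q - g1 p) * (g2 s - g2 p) - (g1 s - g1 p) * (g2 q - g2 p))
        + (f s - f p) * ((g1 q - g1 p) * (g2 r - g2 p) - (g1 r - g1 p) * (g2 q - g2 p))) := by
  simp only [cob, strat]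
  ring

theorem abs_mul_sub_mul_le {a x y z w A B C : ℝ} (ha : |a| ≤ A) (hx : |x| ≤ B) (hy : |y| ≤ C)
    (hz : |z| ≤ B) (hw : |w| ≤ C) : |a * (x * y - z * w)| ≤ 2 * (A * B * C) := by
  have hA : 0 ≤ A := (abs_nonneg a).trans ha
  have hB : 0 ≤ B := (abs_nonneg x).trans hx
  have hxy : |x * y| ≤ B * C := by rw [abs_mul]; gcongr
  have hzw : |z * w| ≤ B * C := by rw [abs_mul]; gcongr
  calc |a * (x * y - z * w)| ≤ A * (B * C + B * C) := by
        rw [abs_mul]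
        gcongr
        exact (abs_sub _ _).trans (add_le_add hxy hzw)
    _ = 2 * (A * B * C) := by ring

/-- `|(δ strat)_{pqrs}| ≤ 8·[f]_α·[g¹]_{β₁}·[g²]_{β₂}·diam([pqrs])^{α+β₁+β₂}`. -/
theorem stmt_5 (α β₁ β₂ : ℝ) (hα : α ∈ Set.Ioc (0:ℝ) 1) (hβ₁ : β₁ ∈ Set.Ioc (0:ℝ) 1)
    (hβ₂ : β₂ ∈ Set.Ioc (0:ℝ) 1)
    (f g1 g2 : E2 → ℝ) (Hf H1 H2 : ℝ) (hHf0 : 0 ≤ Hf) (hH10 : 0 ≤ H1) (hH20 : 0 ≤ H2)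
    (hf : ∀ x y, |f x - f y| ≤ Hf * dist x y ^ α)
    (hg1 : ∀ x y, |g1 x - g1 y| ≤ H1 * dist x y ^ β₁)
    (hg2 : ∀ x y, |g2 x - g2 y| ≤ H2 * dist x y ^ β₂)
    (p q r s : E2) :
    |cob (strat f g1 g2) p q r s| ≤
      8 * Hf * H1 * H2 * Metric.diam ({p, q, r, s} : Set E2) ^ (α + β₁ + β₂) := by
  set S : Set E2 := {p, q, r, s} with hS
  have hbdd : Bornology.IsBounded S := (Set.toFinite S).isBounded
  set D := Metric.diam S
  have hD : 0 ≤ D := Metric.diam_nonneg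
  have holder_diam : ∀ (h : E2 → ℝ) (H γ : ℝ), 0 ≤ H → γ ∈ Set.Ioc (0:ℝ) 1 →
      (∀ x y, |h x - h y| ≤ H * dist x y ^ γ) → ∀ x ∈ S, |h x - h p| ≤ H * D ^ γ := by
    intro h H γ hH hγ hh x hx
    refine (hh x p).trans (mul_le_mul_of_nonneg_left ?_ hH)
    exact Real.rpow_le_rpow dist_nonneg
      (Metric.dist_le_diam_of_mem hbdd hx (by simp [hS])) hγ.1.le
  have hq : q ∈ S := by simp [hS]
  have hr : r ∈ S := by simp [hS]
  have hs : s ∈ S := by simp [hS]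
  have Bf := holder_diam f Hf α hHf0 hα hf
  have B1 := holder_diam g1 H1 β₁ hH10 hβ₁ hg1
  have B2 := holder_diam g2 H2 β₂ hH20 hβ₂ hg2
  have hsplit : D ^ (α + β₁ + β₂) = D ^ α * D ^ β₁ * D ^ β₂ := by
    rw [Real.rpow_add_of_nonneg hD (add_nonneg hα.1.le hβ₁.1.le) hβ₂.1.le,
      Real.rpow_add_of_nonneg hD hα.1.le hβ₁.1.le]
  have hprod : 0 ≤ (Hf * D ^ α) * (H1 * D ^ β₁) * (H2 * D ^ β₂) := by positivity
  have hprs := abs_le.mp (abs_mul_sub_mul_le (Bf q hq) (B1 r hr) (B2 s hs) (B1 s hs) (B2 r hr))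
  have hpqs := abs_le.mp (abs_mul_sub_mul_le (Bf r hr) (B1 q hq) (B2 s hs) (B1 s hs) (B2 q hq))
  have hpqr := abs_le.mp (abs_mul_sub_mul_le (Bf s hs) (B1 q hq) (B2 r hr) (B1 r hr) (B2 q hq))
  have hrhs : 8 * Hf * H1 * H2 * D ^ (α + β₁ + β₂) =
      8 * ((Hf * D ^ α) * (H1 * D ^ β₁) * (H2 * D ^ β₂)) := by
    rw [hsplit]; ring
  rw [cob_strat_eq, hrhs, abs_le]
  constructor <;> linarith
end
end

section
/- For all functions f, g¹, g² : ℝ² → ℝ and all points p, q, r, s ∈ ℝ² one has (δ strat)_{pqrs} = (1/6)·det M, where M is the 3×3 matrix with rows (δf_{pq}, δf_{pr}, δf_{ps}), (δg¹_{pq}, δg¹_{pr}, δg¹_{ps}), (δg²_{pq}, δg²_{pr}, δg²_{ps}). -/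
open Filter Metric

noncomputable section

/-- `(δ strat)_{pqrs}` equals one sixth of the determinant of the matrix of
increments of `f`, `g¹`, `g²`. -/
theorem stmt_6 (f g1 g2 : E2 → ℝ) (p q r s : E2) :
    cob (strat f g1 g2) p q r s =
      (1/6) * Matrix.det !![f q - f p, f r - f p, f s - f p;
                            g1 q - g1 p, g1 r - g1 p, g1 s - g1 p;
                            g2 q - g2 p, g2 r - g2 p, g2 s - g2 p] := by
  simp only [cob, strat, Matrix.det_fin_three, Matrix.of_apply, Matrix.cons_val]
  ring
end
end

section
/- Let ω : (ℝ²)³ → ℝ be a 2-germ and suppose there are constants C₁ > 0 and γ₁ > 0 such that |ω_{pqr}| ≤ C₁·diam([pqr])^{γ₁} for all p, q, r ∈ ℝ². Then for every n ∈ ℕ and all p, q ∈ ℝ² one has |S^{n+1}_{pq} − S^n_{pq}| ≤ C₁·2^{n(1−γ₁)}·|p − q|^{γ₁}. -/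
open Filter Metric

noncomputable section

/-- The diameter of a segment's endpoints together with its midpoint is at most its length. -/
theorem diam_insert_midpoint_le (p q : E2) :
    Metric.diam ({p, midpoint ℝ p q, q} : Set E2) ≤ dist p q := by
  have hsub : ({p, midpoint ℝ p q, q} : Set E2) ⊆ segment ℝ p q := by
    rintro x (rfl | rfl | rfl)
    · exact left_mem_segment ℝ _ _
    · exact midpoint_mem_segment p q
    · exact right_mem_segment ℝ _ _
  calc Metric.diam ({p, midpoint ℝ p q, q} : Set E2)
      ≤ Metric.diam (convexHull ℝ {p, q}) := by
        rw [convexHull_pair]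
        exact Metric.diam_mono hsub
          (convexHull_pair (𝕜 := ℝ) p q ▸ isBounded_convexHull.2 (Set.toFinite {p, q}).isBounded)
    _ = dist p q := by rw [convexHull_diam, Metric.diam_pair]

/-- Halving the length of a segment and doubling the number of segments scales the
dyadic bound from level `n` to level `n + 1`. -/
theorem two_mul_two_rpow_mul_half_rpow (n : ℕ) (γ : ℝ) {d : ℝ} (hd : 0 ≤ d) :
    2 * ((2 : ℝ) ^ ((n : ℝ) * (1 - γ)) * (2⁻¹ * d) ^ γ) =
      (2 : ℝ) ^ (((n + 1 : ℕ) : ℝ) * (1 - γ)) * d ^ γ := by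
  have h2 : (0 : ℝ) < 2 := two_pos
  rw [Real.mul_rpow (by positivity) hd, Real.inv_rpow h2.le, Nat.cast_succ, add_mul, one_mul,
    Real.rpow_add h2, Real.rpow_sub h2, Real.rpow_one]
  ring

/-- increment estimate for the side correctors. -/
theorem stmt_7 (ω : E2 → E2 → E2 → ℝ) (C₁ γ₁ : ℝ) (hC₁ : 0 < C₁) (hγ₁ : 0 < γ₁)
    (hω : ∀ p q r, |ω p q r| ≤ C₁ * Metric.diam ({p, q, r} : Set E2) ^ γ₁)
    (n : ℕ) (p q : E2) :
    |sideCorr ω (n + 1) p q - sideCorr ω n p q| ≤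
      C₁ * (2:ℝ) ^ ((n : ℝ) * (1 - γ₁)) * dist p q ^ γ₁ := by
  induction n generalizing p q with
  | zero =>
    simp only [sideCorr, Nat.cast_zero, zero_mul, Real.rpow_zero, mul_one, add_zero, sub_zero]
    refine (hω _ _ _).trans ?_
    have := diam_insert_midpoint_le p q
    gcongr
  | succ n ih =>
    have hl := ih p (midpoint ℝ p q)
    have hr := ih (midpoint ℝ p q) q
    rw [dist_left_midpoint, Real.norm_ofNat] at hl
    rw [dist_midpoint_right, Real.norm_ofNat] at hr
    have hsplit : sideCorr ω (n + 1 + 1) p q - sideCorr ω (n + 1) p q =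
        (sideCorr ω (n + 1) p (midpoint ℝ p q) - sideCorr ω n p (midpoint ℝ p q)) +
          (sideCorr ω (n + 1) (midpoint ℝ p q) q - sideCorr ω n (midpoint ℝ p q) q) := by
      rw [sideCorr, sideCorr.eq_2 ω n]
      ring
    rw [hsplit, mul_assoc, ← two_mul_two_rpow_mul_half_rpow n γ₁ dist_nonneg]
    refine (abs_add_le _ _).trans ((add_le_add hl hr).trans_eq ?_)
    ring
end
end

section
/- Let ω : (ℝ²)³ → ℝ be an alternating 2-germ and suppose there are constants C₂ > 0 and γ₂ > 0 such that |(δω)_{pqrs}| ≤ C₂·diam([pqrs])^{γ₂} for all p, q, r, s ∈ ℝ². Then for every n ∈ ℕ and all p, q, r ∈ ℝ² one has |(ω^n_{pqr} − (δS^n)_{pqr}) − (ω^{n+1}_{pqr} − (δS^{n+1})_{pqr})| ≤ 4·C₂·2^{n(2−γ₂)}·diam([pqr])^{γ₂}. -/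
open Filter Metric

noncomputable section

/-- Exchanging the first two arguments of an alternating germ flips its sign. -/
theorem Alternating2.swap_left {ω : E2 → E2 → E2 → ℝ} (h : Alternating2 ω) (p q r : E2) :
    ω q p r = -ω p q r := by
  have := h (Equiv.swap 0 1) ![p, q, r]
  rw [Equiv.Perm.sign_swap (by decide), Equiv.swap_apply_left, Equiv.swap_apply_right,
    Equiv.swap_apply_of_ne_of_ne (by decide) (by decide)] at this
  simpa using this

/-- Exchanging the last two arguments of an alternating germ flips its sign. -/
theorem Alternating2.swap_right {ω : E2 → E2 → E2 → ℝ} (h : Alternating2 ω) (p q r : E2) :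
    ω p r q = -ω p q r := by
  have := h (Equiv.swap 1 2) ![p, q, r]
  rw [Equiv.Perm.sign_swap (by decide), Equiv.swap_apply_left, Equiv.swap_apply_right,
    Equiv.swap_apply_of_ne_of_ne (by decide) (by decide)] at this
  simpa using this

/-- The side correctors of an alternating germ are antisymmetric. -/
theorem Alternating2.sideCorr_swap {ω : E2 → E2 → E2 → ℝ} (h : Alternating2 ω) (n : ℕ)
    (p q : E2) : sideCorr ω n q p = -sideCorr ω n p q := by
  induction n generalizing p q with
  | zero => simp [sideCorr]
  | succ n ih =>
    simp only [sideCorr, midpoint_comm (R := ℝ) q p]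
    rw [ih (midpoint ℝ p q) q, ih p (midpoint ℝ p q)]
    linarith [h.swap_left (midpoint ℝ p q) q p, h.swap_right (midpoint ℝ p q) p q,
      h.swap_left p (midpoint ℝ p q) q]

/-- The increment from level `n` to level `n + 1` of the corrected dyadic sums
(with the opposite sign). -/
def corrIncr (ω : E2 → E2 → E2 → ℝ) (n : ℕ) (p q r : E2) : ℝ :=
  (dyaSum ω n p q r - (sideCorr ω n q r - sideCorr ω n p r + sideCorr ω n p q))
    - (dyaSum ω (n + 1) p q r
      - (sideCorr ω (n + 1) q r - sideCorr ω (n + 1) p r + sideCorr ω (n + 1) p q))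

/-- At level zero the increment is a sum of four coboundaries. -/
theorem Alternating2.corrIncr_zero {ω : E2 → E2 → E2 → ℝ} (h : Alternating2 ω) (p q r : E2) :
    corrIncr ω 0 p q r =
      -(cob ω p q r (midpoint ℝ q r)
        + cob ω p (midpoint ℝ q r) r (midpoint ℝ p r)
        + cob ω p q (midpoint ℝ q r) (midpoint ℝ p q)
        + cob ω p (midpoint ℝ q r) (midpoint ℝ p r) (midpoint ℝ p q)) := by
  simp only [corrIncr, dyaSum, sideCorr, cob]
  generalize midpoint ℝ q r = a
  generalize midpoint ℝ p r = b
  generalize midpoint ℝ p q = c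
  linarith [h.swap_right q a r, h.swap_right a r b, h.swap_left a b r, h.swap_right p r b,
    h.swap_right q a c, h.swap_left q c a, h.swap_right p a c, h.swap_right p c q,
    h.swap_right p b c, h.swap_right p a r]

/-- The increments at successive levels are related by dyadic subdivision. -/
theorem Alternating2.corrIncr_succ {ω : E2 → E2 → E2 → ℝ} (h : Alternating2 ω) (n : ℕ)
    (p q r : E2) :
    corrIncr ω (n + 1) p q r =
      corrIncr ω n (midpoint ℝ q r) (midpoint ℝ p r) (midpoint ℝ p q)
      + corrIncr ω n (midpoint ℝ p r) (midpoint ℝ q r) r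
      + corrIncr ω n (midpoint ℝ p q) q (midpoint ℝ q r)
      + corrIncr ω n p (midpoint ℝ p q) (midpoint ℝ p r) := by
  have hd (m : ℕ) (p q r : E2) : dyaSum ω (m + 1) p q r =
      dyaSum ω m (midpoint ℝ q r) (midpoint ℝ p r) (midpoint ℝ p q)
      + dyaSum ω m (midpoint ℝ p r) (midpoint ℝ q r) r
      + dyaSum ω m (midpoint ℝ p q) q (midpoint ℝ q r)
      + dyaSum ω m p (midpoint ℝ p q) (midpoint ℝ p r) := rfl
  have hs (m : ℕ) (p q : E2) : sideCorr ω (m + 1) p q =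
      ω p (midpoint ℝ p q) q + sideCorr ω m p (midpoint ℝ p q)
        + sideCorr ω m (midpoint ℝ p q) q := rfl
  unfold corrIncr
  rw [hd (n + 1) p q r, hd n p q r, hs (n + 1) q r, hs (n + 1) p r, hs (n + 1) p q,
    hs n q r, hs n p r, hs n p q]
  generalize midpoint ℝ q r = a
  generalize midpoint ℝ p r = b
  generalize midpoint ℝ p q = c
  linarith [h.sideCorr_swap n a b, h.sideCorr_swap n b c, h.sideCorr_swap n a c,
    h.sideCorr_swap (n + 1) a b, h.sideCorr_swap (n + 1) b c, h.sideCorr_swap (n + 1) a c]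

/-- A subset of the convex hull of a triangle has at most the diameter of the triangle. -/
theorem diam_le_of_subset_convexHull_triple {s : Set E2} {p q r : E2}
    (hs : s ⊆ convexHull ℝ {p, q, r}) : diam s ≤ diam ({p, q, r} : Set E2) := by
  rw [← convexHull_diam ({p, q, r} : Set E2)]
  exact diam_mono hs (isBounded_convexHull.2 (Set.toFinite _).isBounded)

/-- The diameter of a triple is bounded by any common bound of its side lengths. -/
theorem diam_triple_le {a b c : E2} {d : ℝ} (hab : dist a b ≤ d) (hac : dist a c ≤ d)
    (hbc : dist b c ≤ d) : diam ({a, b, c} : Set E2) ≤ d := by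
  rw [diam_triple]
  exact max_le (max_le hab hac) hbc

/-- Two midpoints of segments with a common endpoint are at half the distance of the
other endpoints. -/
theorem dist_midpoint_midpoint_left (p q r : E2) :
    dist (midpoint ℝ p q) (midpoint ℝ p r) = dist q r / 2 := by
  have : midpoint ℝ p q - midpoint ℝ p r = (2⁻¹ : ℝ) • (q - r) := by
    simp only [midpoint_eq_smul_add, invOf_eq_inv]
    module
  rw [dist_eq_norm, this, norm_smul, dist_eq_norm]
  norm_num
  ring

/-- The level-zero increment bound. -/
theorem Alternating2.abs_corrIncr_zero_le {ω : E2 → E2 → E2 → ℝ} (h : Alternating2 ω)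
    {C γ : ℝ} (hC : 0 ≤ C) (hγ : 0 ≤ γ)
    (hω : ∀ p q r s, |cob ω p q r s| ≤ C * diam ({p, q, r, s} : Set E2) ^ γ) (p q r : E2) :
    |corrIncr ω 0 p q r| ≤ 4 * C * diam ({p, q, r} : Set E2) ^ γ := by
  have hp : p ∈ convexHull ℝ {p, q, r} := subset_convexHull ℝ _ (by simp)
  have hq : q ∈ convexHull ℝ {p, q, r} := subset_convexHull ℝ _ (by simp)
  have hr : r ∈ convexHull ℝ {p, q, r} := subset_convexHull ℝ _ (by simp)
  have hconv := convex_convexHull ℝ ({p, q, r} : Set E2)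
  have ha := hconv.midpoint_mem hq hr
  have hb := hconv.midpoint_mem hp hr
  have hc := hconv.midpoint_mem hp hq
  have key {x y z w : E2} (hx : x ∈ convexHull ℝ {p, q, r}) (hy : y ∈ convexHull ℝ {p, q, r})
      (hz : z ∈ convexHull ℝ {p, q, r}) (hw : w ∈ convexHull ℝ {p, q, r}) :
      |cob ω x y z w| ≤ C * diam ({p, q, r} : Set E2) ^ γ := by
    refine (hω x y z w).trans (mul_le_mul_of_nonneg_left
      (Real.rpow_le_rpow diam_nonneg (diam_le_of_subset_convexHull_triple ?_) hγ) hC)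
    simp [Set.insert_subset_iff, hx, hy, hz, hw]
  rw [h.corrIncr_zero, abs_neg]
  refine (abs_add_le _ _).trans ?_
  linarith [abs_add_three (cob ω p q r (midpoint ℝ q r))
      (cob ω p (midpoint ℝ q r) r (midpoint ℝ p r))
      (cob ω p q (midpoint ℝ q r) (midpoint ℝ p q)),
    key hp hq hr ha, key hp ha hr hb, key hp hq ha hc, key hp ha hb hc]

/-- Dyadic subdivision propagates the level-zero increment bound to every level. -/
theorem Alternating2.abs_corrIncr_le {ω : E2 → E2 → E2 → ℝ} (h : Alternating2 ω)
    {C γ : ℝ} (hC : 0 ≤ C) (hγ : 0 ≤ γ)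
    (hω : ∀ p q r s, |cob ω p q r s| ≤ C * diam ({p, q, r, s} : Set E2) ^ γ)
    (n : ℕ) (p q r : E2) :
    |corrIncr ω n p q r| ≤
      4 * C * (2 : ℝ) ^ ((n : ℝ) * (2 - γ)) * diam ({p, q, r} : Set E2) ^ γ := by
  induction n generalizing p q r with
  | zero => simpa using h.abs_corrIncr_zero_le hC hγ hω p q r
  | succ n ih =>
    set d := diam ({p, q, r} : Set E2)
    have hd0 : 0 ≤ d := diam_nonneg
    have hbdd : Bornology.IsBounded ({p, q, r} : Set E2) := (Set.toFinite _).isBounded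
    have hpq : dist p q ≤ d := dist_le_diam_of_mem hbdd (by simp) (by simp)
    have hpr : dist p r ≤ d := dist_le_diam_of_mem hbdd (by simp) (by simp)
    have hqr : dist q r ≤ d := dist_le_diam_of_mem hbdd (by simp) (by simp)
    have half {x y : E2} (hxy : dist x y ≤ d) :
        dist (midpoint ℝ x y) y ≤ d / 2 ∧ dist x (midpoint ℝ x y) ≤ d / 2 := by
      rw [dist_midpoint_right, dist_left_midpoint]
      norm_num
      linarith
    have hab : dist (midpoint ℝ q r) (midpoint ℝ p r) ≤ d / 2 := by
      rw [midpoint_comm q r, midpoint_comm p r, dist_midpoint_midpoint_left, dist_comm]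
      linarith
    have hac : dist (midpoint ℝ q r) (midpoint ℝ p q) ≤ d / 2 := by
      rw [midpoint_comm p q, dist_midpoint_midpoint_left, dist_comm]
      linarith
    have hbc : dist (midpoint ℝ p r) (midpoint ℝ p q) ≤ d / 2 := by
      rw [dist_midpoint_midpoint_left, dist_comm]
      linarith
    have key {x y z : E2} (hxy : dist x y ≤ d / 2) (hxz : dist x z ≤ d / 2)
        (hyz : dist y z ≤ d / 2) : |corrIncr ω n x y z| ≤
          4 * C * (2 : ℝ) ^ ((n : ℝ) * (2 - γ)) * (d / 2) ^ γ :=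
      (ih x y z).trans (mul_le_mul_of_nonneg_left
        (Real.rpow_le_rpow diam_nonneg (diam_triple_le hxy hxz hyz) hγ) (by positivity))
    have hscale : 4 * C * (2 : ℝ) ^ (((n + 1 : ℕ) : ℝ) * (2 - γ)) * d ^ γ =
        4 * (4 * C * (2 : ℝ) ^ ((n : ℝ) * (2 - γ)) * (d / 2) ^ γ) := by
      have h2 : (2 : ℝ) ^ (2 - γ) = 4 / 2 ^ γ := by
        rw [Real.rpow_sub two_pos, Real.rpow_two]
        norm_num
      rw [Nat.cast_succ, add_one_mul, Real.rpow_add two_pos, h2, Real.div_rpow hd0 two_pos.le]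
      ring
    rw [h.corrIncr_succ, hscale]
    refine (abs_add_le _ _).trans ?_
    linarith [abs_add_three (corrIncr ω n (midpoint ℝ q r) (midpoint ℝ p r) (midpoint ℝ p q))
        (corrIncr ω n (midpoint ℝ p r) (midpoint ℝ q r) r)
        (corrIncr ω n (midpoint ℝ p q) q (midpoint ℝ q r)),
      key hab hac hbc, key ((dist_comm _ _).trans_le hab) (half hpr).1 (half hqr).1,
      key (half hpq).1 ((dist_comm _ _).trans_le hac) (half hqr).2,
      key (half hpq).2 (half hpr).2 ((dist_comm _ _).trans_le hbc)]

/-- increment estimate for the corrected dyadic sums of an alternating germ. -/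
theorem stmt_8 (ω : E2 → E2 → E2 → ℝ) (halt : Alternating2 ω)
    (C₂ γ₂ : ℝ) (hC₂ : 0 < C₂) (hγ₂ : 0 < γ₂)
    (hδω : ∀ p q r s, |cob ω p q r s| ≤ C₂ * Metric.diam ({p, q, r, s} : Set E2) ^ γ₂)
    (n : ℕ) (p q r : E2) :
    |(dyaSum ω n p q r - (sideCorr ω n q r - sideCorr ω n p r + sideCorr ω n p q))
      - (dyaSum ω (n + 1) p q r
          - (sideCorr ω (n + 1) q r - sideCorr ω (n + 1) p r + sideCorr ω (n + 1) p q))| ≤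
      4 * C₂ * (2:ℝ) ^ ((n : ℝ) * (2 - γ₂)) * Metric.diam ({p, q, r} : Set E2) ^ γ₂ := by
  exact halt.abs_corrIncr_le hC₂.le hγ₂.le hδω n p q r
end
end

section
/- Let α, β₁, β₂ ∈ (0,1] with α + β₁ + β₂ > 2, let f : ℝ² → ℝ be bounded and α-Hölder, and let gⁱ : ℝ² → ℝ be βᵢ-Hölder for i = 1, 2. If the points p, q, r ∈ ℝ² are collinear (i.e. the triangle with vertices p, q, r has zero area, det(q − p, r − p) = 0), then lim_{n→∞} strat^n_{pqr} = 0. -/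
open Filter Metric

noncomputable section

/-- Dyadic sums of a 2-germ on the real line. -/
def lineDyaSum (w : ℝ → ℝ → ℝ → ℝ) : ℕ → ℝ → ℝ → ℝ → ℝ
  | 0 => w
  | n + 1 => fun a b c =>
      lineDyaSum w n (midpoint ℝ b c) (midpoint ℝ a c) (midpoint ℝ a b)
      + lineDyaSum w n (midpoint ℝ a c) (midpoint ℝ b c) c
      + lineDyaSum w n (midpoint ℝ a b) b (midpoint ℝ b c)
      + lineDyaSum w n a (midpoint ℝ a b) (midpoint ℝ a c)

/-- Dyadic sums of a 1-germ on the real line. -/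
def edgeDyaSum (S : ℝ → ℝ → ℝ) : ℕ → ℝ → ℝ → ℝ
  | 0 => S
  | n + 1 => fun a b => edgeDyaSum S n a (midpoint ℝ a b) + edgeDyaSum S n (midpoint ℝ a b) b

lemma dyaSum_comp_affineMap (ω : E2 → E2 → E2 → ℝ) (γ : ℝ →ᵃ[ℝ] E2) (n : ℕ) (a b c : ℝ) :
    dyaSum ω n (γ a) (γ b) (γ c) =
      lineDyaSum (fun x y z => ω (γ x) (γ y) (γ z)) n a b c := by
  induction n generalizing a b c with
  | zero => rfl
  | succ n ih => simp only [dyaSum, lineDyaSum, ← AffineMap.map_midpoint, ih]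

lemma edgeDyaSum_antisymm {S : ℝ → ℝ → ℝ} (hS : ∀ a b, S b a = -S a b) (n : ℕ) (a b : ℝ) :
    edgeDyaSum S n b a = -edgeDyaSum S n a b := by
  induction n generalizing a b with
  | zero => exact hS a b
  | succ n ih =>
    simp only [edgeDyaSum, midpoint_comm b a, ih a (midpoint ℝ a b), ih (midpoint ℝ a b) b]
    ring

lemma real_midpoint_eq (a b : ℝ) : midpoint ℝ a b = (a + b) / 2 := by
  rw [midpoint_eq_smul_add, smul_eq_mul, invOf_eq_inv]
  ring

lemma abs_edgeDyaSum_le {S : ℝ → ℝ → ℝ} {d η : ℝ} (hS : ∀ a b, |a - b| ≤ d → |S a b| ≤ η)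
    (n : ℕ) (a b : ℝ) (hab : |a - b| ≤ 2 ^ n * d) : |edgeDyaSum S n a b| ≤ 2 ^ n * η := by
  induction n generalizing a b with
  | zero => simpa [edgeDyaSum] using hS a b (by simpa using hab)
  | succ n ih =>
    rw [pow_succ, abs_le] at hab
    have hleft := ih a (midpoint ℝ a b) (by
      rw [real_midpoint_eq, abs_le]; constructor <;> linarith)
    have hright := ih (midpoint ℝ a b) b (by
      rw [real_midpoint_eq, abs_le]; constructor <;> linarith)
    simp only [edgeDyaSum]
    rw [pow_succ]
    exact (abs_add_le _ _).trans (by linarith)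

/-- If a 2-germ is close to the boundary of an antisymmetric 1-germ at scale `d`, its dyadic sums
are close to the boundary of the dyadic sums of the 1-germ, since interior edges cancel. -/
lemma abs_lineDyaSum_sub_le {w : ℝ → ℝ → ℝ → ℝ} {S : ℝ → ℝ → ℝ} {d ε : ℝ}
    (hS : ∀ a b, S b a = -S a b)
    (hw : ∀ a b c, |a - b| ≤ d → |b - c| ≤ d → |c - a| ≤ d →
      |w a b c - (S a b + S b c + S c a)| ≤ ε)
    (n : ℕ) (a b c : ℝ) (hab : |a - b| ≤ 2 ^ n * d) (hbc : |b - c| ≤ 2 ^ n * d)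
    (hca : |c - a| ≤ 2 ^ n * d) :
    |lineDyaSum w n a b c - (edgeDyaSum S n a b + edgeDyaSum S n b c + edgeDyaSum S n c a)|
      ≤ 4 ^ n * ε := by
  induction n generalizing a b c with
  | zero =>
    simpa [edgeDyaSum, lineDyaSum] using
      hw a b c (by simpa using hab) (by simpa using hbc) (by simpa using hca)
  | succ n ih =>
    rw [pow_succ, abs_le] at hab hbc hca
    have hinner := ih (midpoint ℝ b c) (midpoint ℝ a c) (midpoint ℝ a b)
      (by rw [real_midpoint_eq, real_midpoint_eq, abs_le]; constructor <;> linarith)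
      (by rw [real_midpoint_eq, real_midpoint_eq, abs_le]; constructor <;> linarith)
      (by rw [real_midpoint_eq, real_midpoint_eq, abs_le]; constructor <;> linarith)
    have hc := ih (midpoint ℝ a c) (midpoint ℝ b c) c
      (by rw [real_midpoint_eq, real_midpoint_eq, abs_le]; constructor <;> linarith)
      (by rw [real_midpoint_eq, abs_le]; constructor <;> linarith)
      (by rw [real_midpoint_eq, abs_le]; constructor <;> linarith)
    have hb := ih (midpoint ℝ a b) b (midpoint ℝ b c)
      (by rw [real_midpoint_eq, abs_le]; constructor <;> linarith)
      (by rw [real_midpoint_eq, abs_le]; constructor <;> linarith)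
      (by rw [real_midpoint_eq, real_midpoint_eq, abs_le]; constructor <;> linarith)
    have ha := ih a (midpoint ℝ a b) (midpoint ℝ a c)
      (by rw [real_midpoint_eq, abs_le]; constructor <;> linarith)
      (by rw [real_midpoint_eq, real_midpoint_eq, abs_le]; constructor <;> linarith)
      (by rw [real_midpoint_eq, abs_le]; constructor <;> linarith)
    have hanti := edgeDyaSum_antisymm hS n
    have hcancel₁ := hanti (midpoint ℝ b c) (midpoint ℝ a c)
    have hcancel₂ := hanti (midpoint ℝ a c) (midpoint ℝ a b)
    have hcancel₃ := hanti (midpoint ℝ a b) (midpoint ℝ b c)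
    simp only [edgeDyaSum, lineDyaSum, midpoint_comm c a]
    rw [pow_succ]
    rw [abs_le] at *
    constructor <;> linarith

lemma exists_int_primitive (b : ℤ → ℝ) : ∃ J : ℤ → ℝ, ∀ k, J (k + 1) = J k + b k := by
  refine ⟨fun k => ∑ i ∈ Finset.range k.toNat, b i -
    ∑ i ∈ Finset.range (-k).toNat, b (-(i + 1 : ℤ)), fun k => ?_⟩
  rcases le_or_gt 0 k with hk | hk
  · lift k to ℕ using hk
    have h₁ : ((k : ℤ) + 1).toNat = k + 1 := by omega
    have h₂ : (-((k : ℤ) + 1)).toNat = 0 := by omega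
    have h₃ : (-(k : ℤ)).toNat = 0 := by omega
    simp only [h₁, h₂, h₃, Finset.sum_range_succ, Finset.sum_range_zero, Int.toNat_natCast]
    ring
  · obtain ⟨m, rfl⟩ : ∃ m : ℕ, k = -(m + 1 : ℤ) := ⟨(-k - 1).toNat, by omega⟩
    have h₁ : (-(m + 1 : ℤ) + 1).toNat = 0 := by omega
    have h₂ : (-(-(m + 1 : ℤ) + 1)).toNat = m := by omega
    have h₃ : (-(m + 1 : ℤ)).toNat = 0 := by omega
    have h₄ : (- -(m + 1 : ℤ)).toNat = m + 1 := by omega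
    simp only [h₁, h₂, h₃, h₄, Finset.sum_range_succ]
    ring

/-- An antisymmetric 1-germ whose boundary has size `κ` at scale `d` can be corrected by an exact
germ so that it has itself size `2 * κ` at scale `d`. -/
lemma exists_primitive_sub_le {B : ℝ → ℝ → ℝ} {d κ : ℝ} (hd : 0 < d)
    (hB : ∀ a b, B b a = -B a b)
    (hκ : ∀ a b c, |a - b| ≤ d → |b - c| ≤ d → |c - a| ≤ d → |B a b + B b c + B c a| ≤ κ) :
    ∃ I : ℝ → ℝ, ∀ a b, |a - b| ≤ d → |B a b - (I b - I a)| ≤ 2 * κ := by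
  obtain ⟨J, hJ⟩ := exists_int_primitive fun k => B (k * d) ((k + 1) * d)
  have hκ0 : 0 ≤ κ := (abs_nonneg _).trans
    (hκ 0 0 0 (by simpa using hd.le) (by simpa using hd.le) (by simpa using hd.le))
  let I : ℝ → ℝ := fun x => J ⌊x / d⌋ + B (⌊x / d⌋ * d) x
  have hordered : ∀ a b, a ≤ b → b - a ≤ d → |B a b - (I b - I a)| ≤ 2 * κ := by
    intro a b hab hbd
    have hfloor_le : ∀ x : ℝ, ⌊x / d⌋ * d ≤ x := fun x =>
      (le_div_iff₀ hd).1 (Int.floor_le (x / d))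
    have hlt_floor : ∀ x : ℝ, x < (⌊x / d⌋ + 1) * d := fun x =>
      (div_lt_iff₀ hd).1 (Int.lt_floor_add_one (x / d))
    have ha := hfloor_le a
    have ha' := hlt_floor a
    have hb := hfloor_le b
    have hb' := hlt_floor b
    have hmono : ⌊a / d⌋ ≤ ⌊b / d⌋ := Int.floor_le_floor (by gcongr)
    have hstep : ⌊b / d⌋ ≤ ⌊a / d⌋ + 1 := by
      rw [← Int.floor_add_one]
      apply Int.floor_le_floor
      rw [div_add_one hd.ne']
      gcongr
      linarith
    rcases (show ⌊b / d⌋ = ⌊a / d⌋ ∨ ⌊b / d⌋ = ⌊a / d⌋ + 1 by omega) with heq | heq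
    · simp only [I, heq] at hb hb' ⊢
      set x : ℝ := ⌊a / d⌋ * d
      have htri := hκ a b x (by rw [abs_le]; constructor <;> linarith)
        (by rw [abs_le]; constructor <;> linarith) (by rw [abs_le]; constructor <;> linarith)
      have hflip := hB x b
      rw [abs_le] at htri ⊢
      constructor <;> linarith
    · simp only [I, heq, hJ] at hb hb' ⊢
      push_cast at hb hb' ⊢
      have hxy : ((⌊a / d⌋ : ℝ) + 1) * d = ⌊a / d⌋ * d + d := by ring
      set x : ℝ := ⌊a / d⌋ * d
      set y : ℝ := ((⌊a / d⌋ : ℝ) + 1) * d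
      have hfirst := hκ a b y (by rw [abs_le]; constructor <;> linarith)
        (by rw [abs_le]; constructor <;> linarith) (by rw [abs_le]; constructor <;> linarith)
      have hsecond := hκ a y x (by rw [abs_le]; constructor <;> linarith)
        (by rw [abs_le]; constructor <;> linarith) (by rw [abs_le]; constructor <;> linarith)
      have hflip₁ := hB y b
      have hflip₂ := hB a y
      have hflip₃ := hB x y
      rw [abs_le] at hfirst hsecond ⊢
      constructor <;> linarith
  refine ⟨I, fun a b hab => ?_⟩
  rcases le_total a b with h | h
  · exact hordered a b h (by linarith [(abs_le.1 hab).1])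
  · have hrev := hordered b a h (by linarith [(abs_le.1 hab).2])
    rw [hB b a, ← abs_neg]
    convert hrev using 2
    ring

/-- The Stratonovich germ on the real line. -/
def lineStrat (F G₁ G₂ : ℝ → ℝ) (a b c : ℝ) : ℝ :=
  (1/2) * ((F a + F b + F c)/3) *
    ((G₁ b - G₁ a) * (G₂ c - G₂ a) - (G₁ c - G₁ a) * (G₂ b - G₂ a))

lemma abs_lineDyaSum_lineStrat_le {F G₁ G₂ : ℝ → ℝ} {d M e h₁ h₂ : ℝ} (hd : 0 < d)
    (hM : ∀ x, |F x| ≤ M) (hF : ∀ x y, |x - y| ≤ d → |F x - F y| ≤ e)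
    (hG₁ : ∀ x y, |x - y| ≤ d → |G₁ x - G₁ y| ≤ h₁)
    (hG₂ : ∀ x y, |x - y| ≤ d → |G₂ x - G₂ y| ≤ h₂)
    (n : ℕ) (a b c : ℝ) (hab : |a - b| ≤ 2 ^ n * d) (hbc : |b - c| ≤ 2 ^ n * d)
    (hca : |c - a| ≤ 2 ^ n * d) :
    |lineDyaSum (lineStrat F G₁ G₂) n a b c| ≤
      4 ^ n * (e * (2 * (h₁ * h₂))) + 3 * (2 ^ n * (M * (2 * (h₁ * h₂)))) := by
  have hself : |(0 : ℝ) - 0| ≤ d := by simpa using hd.le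
  have hM0 : 0 ≤ M := (abs_nonneg _).trans (hM 0)
  have he0 : 0 ≤ e := (abs_nonneg _).trans (hF 0 0 hself)
  have hh₁ : 0 ≤ h₁ := (abs_nonneg _).trans (hG₁ 0 0 hself)
  let B : ℝ → ℝ → ℝ := fun x y => (1/2) * (G₁ x * G₂ y - G₁ y * G₂ x)
  have hprod : ∀ x y z, |y - x| ≤ d → |z - x| ≤ d →
      |(G₁ y - G₁ x) * (G₂ z - G₂ x)| ≤ h₁ * h₂ := by
    intro x y z hy hz
    rw [abs_mul]
    exact mul_le_mul (hG₁ _ _ hy) (hG₂ _ _ hz) (abs_nonneg _) hh₁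
  obtain ⟨I, hI⟩ := exists_primitive_sub_le (B := B) (κ := h₁ * h₂) hd
    (fun x y => by simp only [B]; ring) (by
      intro x y z hxy hyz hzx
      rw [abs_sub_comm] at hxy
      have hyz' := abs_le.1 (hprod x y z hxy hzx)
      have hzy' := abs_le.1 (hprod x z y hzx hxy)
      have hexpand : B x y + B y z + B z x = (1/2) * ((G₁ y - G₁ x) * (G₂ z - G₂ x) -
          (G₁ z - G₁ x) * (G₂ y - G₂ x)) := by simp only [B]; ring
      rw [hexpand, abs_le]
      constructor <;> linarith [hyz'.1, hyz'.2, hzy'.1, hzy'.2])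
  let A : ℝ → ℝ → ℝ := fun x y => B x y - (I y - I x)
  let S : ℝ → ℝ → ℝ := fun x y => (F x + F y) / 2 * A x y
  have hS : ∀ x y, S y x = -S x y := fun x y => by simp only [S, A, B]; ring
  have hSle : ∀ x y, |x - y| ≤ d → |S x y| ≤ M * (2 * (h₁ * h₂)) := by
    intro x y hxy
    have hx := abs_le.1 (hM x)
    have hy := abs_le.1 (hM y)
    simp only [S]
    rw [abs_mul]
    refine mul_le_mul ?_ (hI x y hxy) (abs_nonneg _) hM0
    rw [abs_le]
    constructor <;> linarith
  have hterm : ∀ x y z, |x - y| ≤ d → |y - z| ≤ d → |z - x| ≤ d →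
      |(2 * F z - F x - F y) / 6 * A x y| ≤ e / 3 * (2 * (h₁ * h₂)) := by
    intro x y z hxy hyz hzx
    rw [abs_mul]
    refine mul_le_mul ?_ (hI x y hxy) (abs_nonneg _) (by linarith)
    have hFyz := abs_le.1 (hF y z hyz)
    have hFzx := abs_le.1 (hF z x hzx)
    rw [abs_le]
    constructor <;> linarith
  have hclose : ∀ x y z, |x - y| ≤ d → |y - z| ≤ d → |z - x| ≤ d →
      |lineStrat F G₁ G₂ x y z - (S x y + S y z + S z x)| ≤ e * (2 * (h₁ * h₂)) := by
    intro x y z hxy hyz hzx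
    have hz := abs_le.1 (hterm x y z hxy hyz hzx)
    have hx := abs_le.1 (hterm y z x hyz hzx hxy)
    have hy := abs_le.1 (hterm z x y hzx hxy hyz)
    have hexpand : lineStrat F G₁ G₂ x y z - (S x y + S y z + S z x) =
        (2 * F z - F x - F y) / 6 * A x y + (2 * F x - F y - F z) / 6 * A y z +
          (2 * F y - F z - F x) / 6 * A z x := by
      simp only [lineStrat, S, A, B]; ring
    rw [hexpand, abs_le]
    constructor <;> linarith [hz.1, hz.2, hx.1, hx.2, hy.1, hy.2]
  have hsum := abs_le.1 (abs_lineDyaSum_sub_le hS hclose n a b c hab hbc hca)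
  have hSab := abs_le.1 (abs_edgeDyaSum_le hSle n a b hab)
  have hSbc := abs_le.1 (abs_edgeDyaSum_le hSle n b c hbc)
  have hSca := abs_le.1 (abs_edgeDyaSum_le hSle n c a hca)
  rw [abs_le]
  constructor <;> linarith [hsum.1, hsum.2, hSab.1, hSab.2, hSbc.1, hSbc.2, hSca.1, hSca.2]

lemma tendsto_pow_mul_div_two_pow_rpow {N s D : ℝ} (hN : 0 ≤ N) (hNs : N < 2 ^ s) (hD : 0 ≤ D) :
    Tendsto (fun n : ℕ => N ^ n * (D / 2 ^ n) ^ s) atTop (nhds 0) := by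
  have hpos : (0 : ℝ) < 2 ^ s := by positivity
  have hgeom := (tendsto_pow_atTop_nhds_zero_of_lt_one (r := N / 2 ^ s) (by positivity)
    ((div_lt_one hpos).2 hNs)).mul_const (D ^ s)
  rw [zero_mul] at hgeom
  refine hgeom.congr fun n => ?_
  rw [Real.div_rpow hD (by positivity), div_pow, Real.rpow_pow_comm zero_le_two]
  ring

lemma tendsto_lineDyaSum_lineStrat {F G₁ G₂ : ℝ → ℝ} {α β₁ β₂ M Hf H₁ H₂ : ℝ}
    (hα : 0 < α) (hα1 : α ≤ 1) (hβ₁ : 0 < β₁) (hβ₂ : 0 < β₂) (hsum : 2 < α + β₁ + β₂)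
    (hHf0 : 0 ≤ Hf) (hH₁0 : 0 ≤ H₁) (hH₂0 : 0 ≤ H₂) (hM : ∀ x, |F x| ≤ M)
    (hF : ∀ x y, |F x - F y| ≤ Hf * |x - y| ^ α)
    (hG₁ : ∀ x y, |G₁ x - G₁ y| ≤ H₁ * |x - y| ^ β₁)
    (hG₂ : ∀ x y, |G₂ x - G₂ y| ≤ H₂ * |x - y| ^ β₂) (a b c : ℝ) :
    Tendsto (fun n => lineDyaSum (lineStrat F G₁ G₂) n a b c) atTop (nhds 0) := by
  set D : ℝ := 1 + |a - b| + |b - c| + |c - a| with hD_def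
  have hD : 0 < D := by positivity
  have htwo : (2 : ℝ) < 2 ^ (β₁ + β₂) := by
    simpa using Real.rpow_lt_rpow_of_exponent_lt one_lt_two (show (1 : ℝ) < β₁ + β₂ by linarith)
  have hfour : (4 : ℝ) < 2 ^ (α + β₁ + β₂) := by
    have h := Real.rpow_lt_rpow_of_exponent_lt one_lt_two hsum
    norm_num at h
    exact h
  have hlim := ((tendsto_pow_mul_div_two_pow_rpow (by norm_num) hfour hD.le).const_mul
    (2 * Hf * H₁ * H₂)).add
    ((tendsto_pow_mul_div_two_pow_rpow (by norm_num) htwo hD.le).const_mul (6 * M * H₁ * H₂))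
  rw [mul_zero, mul_zero, add_zero] at hlim
  refine squeeze_zero_norm (fun n => ?_) hlim
  have hd : 0 < D / 2 ^ n := by positivity
  have hscale : 2 ^ n * (D / 2 ^ n) = D := by field_simp
  have hbound := abs_lineDyaSum_lineStrat_le hd hM
    (e := Hf * (D / 2 ^ n) ^ α) (h₁ := H₁ * (D / 2 ^ n) ^ β₁) (h₂ := H₂ * (D / 2 ^ n) ^ β₂)
    (fun x y hxy => (hF x y).trans (by gcongr)) (fun x y hxy => (hG₁ x y).trans (by gcongr))
    (fun x y hxy => (hG₂ x y).trans (by gcongr)) n a b c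
    (by rw [hscale]; linarith [abs_nonneg (b - c), abs_nonneg (c - a)])
    (by rw [hscale]; linarith [abs_nonneg (a - b), abs_nonneg (c - a)])
    (by rw [hscale]; linarith [abs_nonneg (a - b), abs_nonneg (b - c)])
  rw [Real.norm_eq_abs]
  refine hbound.trans (le_of_eq ?_)
  rw [Real.rpow_add hd, Real.rpow_add hd, Real.rpow_add hd]
  ring

/-- Three points of the plane spanning zero area lie on a common parametrized line. -/
lemma exists_lineMap_of_det_eq_zero (p q r : E2)
    (hdeg : (q 0 - p 0) * (r 1 - p 1) - (q 1 - p 1) * (r 0 - p 0) = 0) :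
    ∃ (v : E2) (b c : ℝ), AffineMap.lineMap p v b = q ∧ AffineMap.lineMap p v c = r := by
  by_cases h0 : q 0 - p 0 = 0
  · by_cases h1 : q 1 - p 1 = 0
    · refine ⟨r, 0, 1, ?_, by simp⟩
      ext i
      fin_cases i
      · simp; linarith
      · simp; linarith
    · refine ⟨q, 1, (r 1 - p 1) / (q 1 - p 1), by simp, ?_⟩
      ext i
      fin_cases i
      · simp [AffineMap.lineMap_apply]; field_simp; linarith
      · simp [AffineMap.lineMap_apply]; field_simp; ring
  · refine ⟨q, 1, (r 0 - p 0) / (q 0 - p 0), by simp, ?_⟩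
    ext i
    fin_cases i
    · simp [AffineMap.lineMap_apply]; field_simp; ring
    · simp [AffineMap.lineMap_apply]; field_simp; linarith

lemma holder_comp_lineMap {g : E2 → ℝ} {H β : ℝ} (hg : ∀ x y, |g x - g y| ≤ H * dist x y ^ β)
    (p v : E2) (s t : ℝ) :
    |g (AffineMap.lineMap p v s) - g (AffineMap.lineMap p v t)| ≤
      H * dist p v ^ β * |s - t| ^ β := by
  refine (hg _ _).trans (le_of_eq ?_)
  rw [dist_lineMap_lineMap, Real.dist_eq, Real.mul_rpow (abs_nonneg _) dist_nonneg]
  ring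

/-- the limit of the dyadic Stratonovich sums vanishes on degenerate triangles. -/
theorem stmt_11 (α β₁ β₂ : ℝ) (hα : α ∈ Set.Ioc (0:ℝ) 1) (hβ₁ : β₁ ∈ Set.Ioc (0:ℝ) 1)
    (hβ₂ : β₂ ∈ Set.Ioc (0:ℝ) 1) (hsum : 2 < α + β₁ + β₂)
    (f g1 g2 : E2 → ℝ) (M Hf H1 H2 : ℝ)
    (hM0 : 0 ≤ M) (hHf0 : 0 ≤ Hf) (hH10 : 0 ≤ H1) (hH20 : 0 ≤ H2)
    (hM : ∀ x, |f x| ≤ M)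
    (hf : ∀ x y, |f x - f y| ≤ Hf * dist x y ^ α)
    (hg1 : ∀ x y, |g1 x - g1 y| ≤ H1 * dist x y ^ β₁)
    (hg2 : ∀ x y, |g2 x - g2 y| ≤ H2 * dist x y ^ β₂)
    (p q r : E2)
    (hdeg : (q 0 - p 0) * (r 1 - p 1) - (q 1 - p 1) * (r 0 - p 0) = 0) :
    Tendsto (fun n => dyaSum (strat f g1 g2) n p q r) atTop (nhds 0) := by
  obtain ⟨v, b, c, rfl, rfl⟩ := exists_lineMap_of_det_eq_zero p q r hdeg
  have hlim := tendsto_lineDyaSum_lineStrat hα.1 hα.2 hβ₁.1 hβ₂.1 hsum (by positivity)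
    (by positivity) (by positivity) (fun t => hM (AffineMap.lineMap p v t))
    (holder_comp_lineMap hf p v) (holder_comp_lineMap hg1 p v) (holder_comp_lineMap hg2 p v) 0 b c
  refine hlim.congr fun n => ?_
  have hcomp := dyaSum_comp_affineMap (strat f g1 g2) (AffineMap.lineMap p v) n 0 b c
  rw [AffineMap.lineMap_apply_zero] at hcomp
  exact hcomp.symm
end
end

section
/- Let f : ℝ² → ℝ be bounded and α-Hölder for some α ∈ (0,1], and let g¹, g² : ℝ² → ℝ be continuously differentiable with bounded derivatives (in particular Lipschitz). Then for all p, q, r ∈ ℝ², lim_{n→∞} strat^n_{pqr} = σ(p,q,r)·∫_T f(x)·(∂₁g¹(x)·∂₂g²(x) − ∂₂g¹(x)·∂₁g²(x)) dx, where T := conv{p, q, r} is the closed triangle with vertices p, q, r, the integral is the Lebesgue integral over T, and σ(p,q,r) is the sign of det(q − p, r − p). -/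
open Filter Metric

noncomputable section

open MeasureTheory

/-- The determinant of the edge vectors `q - p` and `r - p`. -/
def edgeDet (p q r : E2) : ℝ :=
  (q 0 - p 0) * (r 1 - p 1) - (q 1 - p 1) * (r 0 - p 0)

/-- The closed standard triangle with vertices `(0,0)`, `(1,0)`, `(0,1)`. -/
def stdTriangle : Set E2 := {x | 0 ≤ x 0 ∧ 0 ≤ x 1 ∧ x 0 + x 1 ≤ 1}

/-- The affine parametrization of the triangle `pqr` by the standard triangle. -/
def triParam (p q r x : E2) : E2 := p + x 0 • (q - p) + x 1 • (r - p)

/-- The signed integral of `h` over the triangle `pqr`. -/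
def triIntegral (h : E2 → ℝ) (p q r : E2) : ℝ :=
  edgeDet p q r * ∫ x in stdTriangle, h (triParam p q r x)

lemma continuous_triParam (p q r : E2) : Continuous (triParam p q r) := by
  unfold triParam; fun_prop

lemma isCompact_stdTriangle : IsCompact stdTriangle := by
  refine Metric.isCompact_of_isClosed_isBounded ?_ ?_
  · have h0 : IsClosed {x : E2 | 0 ≤ x 0} := isClosed_le (by fun_prop) (by fun_prop)
    have h1 : IsClosed {x : E2 | 0 ≤ x 1} := isClosed_le (by fun_prop) (by fun_prop)
    have h2 : IsClosed {x : E2 | x 0 + x 1 ≤ 1} := isClosed_le (by fun_prop) (by fun_prop)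
    exact h0.inter (h1.inter h2)
  · refine isBounded_iff_forall_norm_le.2 ⟨2, ?_⟩
    rintro x ⟨h0, h1, h2⟩
    rw [EuclideanSpace.norm_eq]
    refine Real.sqrt_le_iff.2 ⟨by norm_num, ?_⟩
    simp only [Fin.sum_univ_two, Real.norm_eq_abs, sq_abs]
    nlinarith

lemma measurableSet_stdTriangle : MeasurableSet stdTriangle :=
  isCompact_stdTriangle.measurableSet

lemma volume_line_eq_zero (a b c : ℝ) (hab : a ≠ 0 ∨ b ≠ 0) :
    volume {x : E2 | a * x 0 + b * x 1 = c} = 0 := by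
  have hpos : 0 < a ^ 2 + b ^ 2 := by
    rcases hab with h | h <;> positivity
  let ℓ : E2 →ₗ[ℝ] ℝ :=
    { toFun := fun x => a * x 0 + b * x 1
      map_add' := fun x y => by simp; ring
      map_smul' := fun t x => by simp; ring }
  have hℓ (x : E2) : ℓ x = a * x 0 + b * x 1 := rfl
  let w : E2 := !₂[c * a / (a ^ 2 + b ^ 2), c * b / (a ^ 2 + b ^ 2)]
  have hw : ℓ w = c := by
    simp only [hℓ, w]
    simp
    field_simp
  have hset : {x : E2 | a * x 0 + b * x 1 = c} =
      (AffineSubspace.mk' w (LinearMap.ker ℓ) : Set E2) := by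
    ext x
    simp only [Set.mem_ofPred_eq, SetLike.mem_coe, AffineSubspace.mem_mk', vsub_eq_sub,
      LinearMap.mem_ker, map_sub, hw, sub_eq_zero, hℓ x]
  rw [hset]
  refine Measure.addHaar_affineSubspace _ _ fun htop => ?_
  have hdir := congrArg AffineSubspace.direction htop
  rw [AffineSubspace.direction_mk', AffineSubspace.direction_top, LinearMap.ker_eq_top] at hdir
  have hv : ℓ !₂[a, b] = 0 := by rw [hdir]; rfl
  rw [hℓ] at hv
  simp at hv
  nlinarith

lemma ae_ne_of_line (a b c : ℝ) (hab : a ≠ 0 ∨ b ≠ 0) :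
    ∀ᵐ x : E2, a * x 0 + b * x 1 ≠ c :=
  measure_eq_zero_iff_ae_notMem.1 (volume_line_eq_zero a b c hab)

lemma integral_comp_homothety (G : E2 → ℝ) (c : E2) (k : ℝ) :
    ∫ x, G (c + k • x) = (k ^ 2)⁻¹ * ∫ x, G x := by
  have h := Measure.integral_comp_smul (volume : Measure E2) (fun y => G (c + y)) k
  rw [h, integral_add_left_eq_self]
  simp

/-- The image of the standard triangle under `x ↦ c + k • x`, for `k ≠ 0`. -/
def homTriangle (c : E2) (k : ℝ) : Set E2 := {y | k⁻¹ • (y - c) ∈ stdTriangle}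

lemma measurableSet_homTriangle (c : E2) (k : ℝ) : MeasurableSet (homTriangle c k) :=
  measurableSet_stdTriangle.preimage (by fun_prop)

lemma setIntegral_stdTriangle_comp_homothety (H : E2 → ℝ) (c : E2) {k : ℝ} (hk : k ≠ 0) :
    ∫ x in stdTriangle, H (c + k • x) = (k ^ 2)⁻¹ * ∫ x, (homTriangle c k).indicator H x := by
  rw [← integral_comp_homothety _ c k, ← integral_indicator measurableSet_stdTriangle]
  congr 1
  ext x
  have : c + k • x ∈ homTriangle c k ↔ x ∈ stdTriangle := by
    simp [homTriangle, smul_smul, hk]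
  by_cases hx : x ∈ stdTriangle
  · rw [Set.indicator_of_mem hx, Set.indicator_of_mem (this.2 hx)]
  · rw [Set.indicator_of_notMem hx, Set.indicator_of_notMem (mt this.1 hx)]

lemma volume_unitSquare :
    volume {x : E2 | 0 ≤ x 0 ∧ x 0 ≤ 1 ∧ 0 ≤ x 1 ∧ x 1 ≤ 1} = 1 := by
  have hset : {x : E2 | 0 ≤ x 0 ∧ x 0 ≤ 1 ∧ 0 ≤ x 1 ∧ x 1 ≤ 1} =
      (@WithLp.ofLp 2 (Fin 2 → ℝ)) ⁻¹' Set.Icc 0 1 := by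
    ext x
    simp [Pi.le_def, Fin.forall_fin_two]
    tauto
  rw [hset, (PiLp.volume_preserving_ofLp (Fin 2)).measure_preimage
    measurableSet_Icc.nullMeasurableSet, Real.volume_Icc_pi]
  simp

lemma volume_real_stdTriangle : volume.real stdTriangle = 1 / 2 := by
  set Q : Set E2 := {x | 0 ≤ x 0 ∧ x 0 ≤ 1 ∧ 0 ≤ x 1 ∧ x 1 ≤ 1} with hQ
  have hQm : MeasurableSet Q := by
    have h (i : Fin 2) : Measurable fun x : E2 => x i := by fun_prop
    exact (measurableSet_le measurable_const (h 0)).inter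
      ((measurableSet_le (h 0) measurable_const).inter
        ((measurableSet_le measurable_const (h 1)).inter
          (measurableSet_le (h 1) measurable_const)))
  have hQv : ∫ x, Q.indicator (fun _ => (1 : ℝ)) x = 1 := by
    rw [integral_indicator_const _ hQm, measureReal_def, volume_unitSquare]; simp
  have hT : ∫ x, stdTriangle.indicator (fun _ => (1 : ℝ)) x = volume.real stdTriangle := by
    rw [integral_indicator_const _ measurableSet_stdTriangle]; simp
  have hi : Integrable (stdTriangle.indicator fun _ => (1 : ℝ)) :=
    (integrable_indicator_iff measurableSet_stdTriangle).2
      (continuous_const.continuousOn.integrableOn_compact isCompact_stdTriangle)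
  have hT' := integral_comp_homothety (stdTriangle.indicator fun _ => (1 : ℝ)) !₂[1, 1] (-1)
  have hi' : Integrable fun x : E2 =>
      stdTriangle.indicator (fun _ => (1 : ℝ)) (!₂[1, 1] + (-1 : ℝ) • x) :=
    (hi.comp_add_left (!₂[1, 1] : E2)).comp_smul (by norm_num)
  have hsum : ∫ x, (stdTriangle.indicator (fun _ => (1 : ℝ)) x +
      stdTriangle.indicator (fun _ => (1 : ℝ)) (!₂[1, 1] + (-1 : ℝ) • x)) =
      ∫ x, Q.indicator (fun _ => (1 : ℝ)) x := by
    refine integral_congr_ae ?_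
    filter_upwards [ae_ne_of_line 1 1 1 (by simp)] with x hx
    simp only [Set.indicator_apply, stdTriangle, hQ, Set.mem_ofPred_eq]
    simp
    grind
  rw [integral_add hi hi', hT', hQv, hT] at hsum
  norm_num at hsum
  linarith

/-- The integral over the standard triangle splits along its midpoint subdivision. -/
lemma integral_stdTriangle_subdivision (H : E2 → ℝ) (hH : Continuous H) :
    ∫ x in stdTriangle, H x = (1 / 4) *
      ((∫ x in stdTriangle, H (!₂[1/2, 1/2] + (-1/2 : ℝ) • x)) +
       (∫ x in stdTriangle, H (!₂[0, 1/2] + (1/2 : ℝ) • x)) +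
       (∫ x in stdTriangle, H (!₂[1/2, 0] + (1/2 : ℝ) • x)) +
       (∫ x in stdTriangle, H (!₂[0, 0] + (1/2 : ℝ) • x))) := by
  have hint (c : E2) (k : ℝ) (hsub : homTriangle c k ⊆ stdTriangle) :
      Integrable ((homTriangle c k).indicator H) :=
    (integrable_indicator_iff (measurableSet_homTriangle c k)).2
      ((hH.continuousOn.integrableOn_compact isCompact_stdTriangle).mono_set hsub)
  rw [setIntegral_stdTriangle_comp_homothety H _ (by norm_num),
    setIntegral_stdTriangle_comp_homothety H _ (by norm_num),
    setIntegral_stdTriangle_comp_homothety H _ (by norm_num),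
    setIntegral_stdTriangle_comp_homothety H _ (by norm_num)]
  have i0 := hint !₂[1/2, 1/2] (-1/2) (by
    rintro x ⟨h0, h1, h2⟩; simp at h0 h1 h2
    exact ⟨by linarith, by linarith, by linarith⟩)
  have i1 := hint !₂[0, 1/2] (1/2) (by
    rintro x ⟨h0, h1, h2⟩; simp at h0 h1 h2
    exact ⟨by linarith, by linarith, by linarith⟩)
  have i2 := hint !₂[1/2, 0] (1/2) (by
    rintro x ⟨h0, h1, h2⟩; simp at h0 h1 h2
    exact ⟨by linarith, by linarith, by linarith⟩)
  have i3 := hint !₂[0, 0] (1/2) (by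
    rintro x ⟨h0, h1, h2⟩; simp at h0 h1 h2
    exact ⟨by linarith, by linarith, by linarith⟩)
  have key : ∫ x in stdTriangle, H x =
      ∫ x, ((homTriangle !₂[1/2, 1/2] (-1/2)).indicator H x +
        (homTriangle !₂[0, 1/2] (1/2)).indicator H x +
        (homTriangle !₂[1/2, 0] (1/2)).indicator H x +
        (homTriangle !₂[0, 0] (1/2)).indicator H x) := by
    rw [← integral_indicator measurableSet_stdTriangle]
    refine integral_congr_ae ?_
    filter_upwards [ae_ne_of_line 1 1 (1/2) (by simp), ae_ne_of_line 1 0 (1/2) (by simp),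
      ae_ne_of_line 0 1 (1/2) (by simp)] with x h1 h2 h3
    simp only [Set.indicator_apply, homTriangle, stdTriangle, Set.mem_ofPred_eq]
    simp
    grind
  have j1 := integral_add i0 i1
  have j2 := integral_add (i0.add i1) i2
  have j3 := integral_add ((i0.add i1).add i2) i3
  simp only [Pi.add_apply] at j1 j2 j3
  rw [key, j3, j2, j1]
  ring

lemma triIntegral_subdivision (h : E2 → ℝ) (hh : Continuous h) (p q r : E2) :
    triIntegral h p q r =
      triIntegral h (midpoint ℝ q r) (midpoint ℝ p r) (midpoint ℝ p q)
      + triIntegral h (midpoint ℝ p r) (midpoint ℝ q r) r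
      + triIntegral h (midpoint ℝ p q) q (midpoint ℝ q r)
      + triIntegral h p (midpoint ℝ p q) (midpoint ℝ p r) := by
  have e0 (x : E2) : triParam (midpoint ℝ q r) (midpoint ℝ p r) (midpoint ℝ p q) x =
      triParam p q r (!₂[1/2, 1/2] + (-1/2 : ℝ) • x) := by
    ext i; simp [triParam, midpoint_eq_smul_add]; ring
  have e1 (x : E2) : triParam (midpoint ℝ p r) (midpoint ℝ q r) r x =
      triParam p q r (!₂[0, 1/2] + (1/2 : ℝ) • x) := by
    ext i; simp [triParam, midpoint_eq_smul_add]; ring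
  have e2 (x : E2) : triParam (midpoint ℝ p q) q (midpoint ℝ q r) x =
      triParam p q r (!₂[1/2, 0] + (1/2 : ℝ) • x) := by
    ext i; simp [triParam, midpoint_eq_smul_add]; ring
  have e3 (x : E2) : triParam p (midpoint ℝ p q) (midpoint ℝ p r) x =
      triParam p q r (!₂[0, 0] + (1/2 : ℝ) • x) := by
    ext i; simp [triParam, midpoint_eq_smul_add]; ring
  have d0 : edgeDet (midpoint ℝ q r) (midpoint ℝ p r) (midpoint ℝ p q) = edgeDet p q r / 4 := by
    simp [edgeDet, midpoint_eq_smul_add]; ring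
  have d1 : edgeDet (midpoint ℝ p r) (midpoint ℝ q r) r = edgeDet p q r / 4 := by
    simp [edgeDet, midpoint_eq_smul_add]; ring
  have d2 : edgeDet (midpoint ℝ p q) q (midpoint ℝ q r) = edgeDet p q r / 4 := by
    simp [edgeDet, midpoint_eq_smul_add]; ring
  have d3 : edgeDet p (midpoint ℝ p q) (midpoint ℝ p r) = edgeDet p q r / 4 := by
    simp [edgeDet, midpoint_eq_smul_add]; ring
  have hs := integral_stdTriangle_subdivision (fun x => h (triParam p q r x))
    (hh.comp (continuous_triParam p q r))
  simp only [triIntegral, e0, e1, e2, e3, d0, d1, d2, d3]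
  rw [hs]
  ring

lemma convex_stdTriangle : Convex ℝ stdTriangle := by
  rintro x ⟨hx0, hx1, hx2⟩ y ⟨hy0, hy1, hy2⟩ a b ha hb hab
  simp only [stdTriangle, Set.mem_ofPred_eq, PiLp.add_apply, PiLp.smul_apply, smul_eq_mul]
  exact ⟨by positivity, by positivity, by nlinarith⟩

lemma triParam_mem_of_convex {S : Set E2} (hS : Convex ℝ S) {p q r x : E2} (hp : p ∈ S)
    (hq : q ∈ S) (hr : r ∈ S) (hx : x ∈ stdTriangle) : triParam p q r x ∈ S := by
  obtain ⟨h0, h1, h2⟩ := hx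
  have h := hS.sum_mem (t := Finset.univ) (w := ![1 - x 0 - x 1, x 0, x 1]) (z := ![p, q, r])
    (by simp [Fin.forall_fin_succ, h0, h1]; linarith) (by simp [Fin.sum_univ_three]; ring)
    (by simp [Fin.forall_fin_succ, hp, hq, hr])
  convert h using 1
  ext i
  simp [Fin.sum_univ_three, triParam]
  ring

lemma convexHull_triple_eq_image (p q r : E2) :
    convexHull ℝ ({p, q, r} : Set E2) = triParam p q r '' stdTriangle := by
  apply Set.Subset.antisymm
  · refine convexHull_min ?_ ?_
    · rintro x (rfl | rfl | rfl)
      · exact ⟨0, by simp [stdTriangle], by simp [triParam]⟩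
      · exact ⟨!₂[1, 0], by simp [stdTriangle], by simp [triParam]⟩
      · exact ⟨!₂[0, 1], by simp [stdTriangle], by simp [triParam]⟩
    · rintro _ ⟨x, hx, rfl⟩ _ ⟨y, hy, rfl⟩ a b ha hb hab
      refine ⟨a • x + b • y, convex_stdTriangle hx hy ha hb hab, ?_⟩
      obtain rfl : b = 1 - a := by linarith
      ext i
      simp [triParam]
      ring
  · rintro _ ⟨x, hx, rfl⟩
    refine triParam_mem_of_convex (convex_convexHull ℝ _) ?_ ?_ ?_ hx <;>
      exact subset_convexHull ℝ _ (by simp)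

/-- The linear part of `triParam p q r`. -/
def triLinear (p q r : E2) : E2 →L[ℝ] E2 :=
  (EuclideanSpace.proj (0 : Fin 2) : E2 →L[ℝ] ℝ).smulRight (q - p) +
    (EuclideanSpace.proj (1 : Fin 2) : E2 →L[ℝ] ℝ).smulRight (r - p)

lemma det_triLinear (p q r : E2) : (triLinear p q r).det = edgeDet p q r := by
  have h : (triLinear p q r).det = LinearMap.det (triLinear p q r : E2 →ₗ[ℝ] E2) := rfl
  rw [h, ← LinearMap.det_toMatrix (EuclideanSpace.basisFun (Fin 2) ℝ).toBasis,
    Matrix.det_fin_two]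
  simp [LinearMap.toMatrix_apply, triLinear, edgeDet]
  ring

lemma triParam_eq_add_triLinear (p q r x : E2) :
    triParam p q r x = p + triLinear p q r x := by
  simp [triParam, triLinear, add_assoc]

lemma sign_mul_integral_convexHull (h : E2 → ℝ) (p q r : E2) :
    Real.sign (edgeDet p q r) * ∫ x in convexHull ℝ ({p, q, r} : Set E2), h x =
      triIntegral h p q r := by
  by_cases hd : edgeDet p q r = 0
  · simp [triIntegral, hd]
  have hinj : Function.Injective (triParam p q r) := by
    intro x y hxy
    rw [triParam_eq_add_triLinear, triParam_eq_add_triLinear, add_right_inj] at hxy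
    have hu : IsUnit (LinearMap.det (triLinear p q r : E2 →ₗ[ℝ] E2)) :=
      isUnit_iff_ne_zero.2 (by rw [← det_triLinear] at hd; exact hd)
    exact ((Module.End.isUnit_iff _).1 ((LinearMap.isUnit_iff_isUnit_det _).2 hu)).injective hxy
  have hder (x : E2) : HasFDerivAt (triParam p q r) (triLinear p q r) x := by
    have : triParam p q r = fun x => p + triLinear p q r x :=
      funext (triParam_eq_add_triLinear p q r)
    rw [this]
    exact (triLinear p q r).hasFDerivAt.const_add p
  rw [convexHull_triple_eq_image, integral_image_eq_integral_abs_det_fderiv_smul volume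
    measurableSet_stdTriangle (fun x _ => (hder x).hasFDerivWithinAt) hinj.injOn]
  simp only [det_triLinear, smul_eq_mul, integral_const_mul, triIntegral]
  rw [← mul_assoc]
  rcases lt_or_gt_of_ne hd with hneg | hpos
  · rw [Real.sign_of_neg hneg, abs_of_neg hneg]; ring
  · rw [Real.sign_of_pos hpos, abs_of_pos hpos]; ring

lemma dist_midpoint_midpoint_right_eq (a b c : E2) :
    dist (midpoint ℝ a c) (midpoint ℝ b c) = dist a b / 2 := by
  rw [dist_eq_norm, dist_eq_norm]
  have : midpoint ℝ a c - midpoint ℝ b c = (1 / 2 : ℝ) • (a - b) := by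
    ext i; simp [midpoint_eq_smul_add]; ring
  rw [this, norm_smul]
  norm_num
  ring

/-- If a germ agrees with a dyadically additive germ up to `ε * d ^ 2` on triangles of diameter at
most `d ≤ δ`, the same bound holds for its dyadic sums on triangles of diameter at most
`2 ^ n * δ`. -/
lemma abs_dyaSum_sub_le {ω A : E2 → E2 → E2 → ℝ} {S : Set E2} (hS : Convex ℝ S) {ε δ : ℝ}
    (hA : ∀ p q r, A p q r =
      A (midpoint ℝ q r) (midpoint ℝ p r) (midpoint ℝ p q)
      + A (midpoint ℝ p r) (midpoint ℝ q r) r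
      + A (midpoint ℝ p q) q (midpoint ℝ q r)
      + A p (midpoint ℝ p q) (midpoint ℝ p r))
    (hloc : ∀ p ∈ S, ∀ q ∈ S, ∀ r ∈ S, ∀ d ≤ δ, dist p q ≤ d → dist p r ≤ d → dist q r ≤ d →
      |ω p q r - A p q r| ≤ ε * d ^ 2) (n : ℕ) :
    ∀ p ∈ S, ∀ q ∈ S, ∀ r ∈ S, ∀ d ≤ 2 ^ n * δ, dist p q ≤ d → dist p r ≤ d → dist q r ≤ d →
      |dyaSum ω n p q r - A p q r| ≤ ε * d ^ 2 := by
  induction n with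
  | zero => simpa [dyaSum] using hloc
  | succ n ih =>
    intro p hp q hq r hr d hd hpq hpr hqr
    have hmid {x y : E2} (hx : x ∈ S) (hy : y ∈ S) : midpoint ℝ x y ∈ S := hS.midpoint_mem hx hy
    have hd' : d / 2 ≤ 2 ^ n * δ := by rw [pow_succ] at hd; linarith
    have hq0 := hmid hq hr
    have hq1 := hmid hp hr
    have hq2 := hmid hp hq
    have half (a b : E2) (hab : dist a b ≤ d) : dist a (midpoint ℝ a b) ≤ d / 2 ∧
        dist (midpoint ℝ a b) b ≤ d / 2 := by
      simp only [dist_left_midpoint, dist_midpoint_right, Real.norm_eq_abs, abs_two]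
      constructor <;> linarith
    have m01 : dist (midpoint ℝ q r) (midpoint ℝ p r) ≤ d / 2 := by
      rw [dist_midpoint_midpoint_right_eq, dist_comm]; linarith
    have m02 : dist (midpoint ℝ q r) (midpoint ℝ p q) ≤ d / 2 := by
      rw [midpoint_comm (R := ℝ) q r, dist_midpoint_midpoint_right_eq, dist_comm]; linarith
    have m12 : dist (midpoint ℝ p r) (midpoint ℝ p q) ≤ d / 2 := by
      rw [midpoint_comm (R := ℝ) p r, midpoint_comm (R := ℝ) p q,
        dist_midpoint_midpoint_right_eq, dist_comm]; linarith
    have b0 := ih _ hq0 _ hq1 _ hq2 _ hd' m01 m02 m12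
    have b1 := ih _ hq1 _ hq0 _ hr _ hd' (by rwa [dist_comm]) (half p r hpr).2 (half q r hqr).2
    have b2 := ih _ hq2 _ hq _ hq0 _ hd' (half p q hpq).2 (by rwa [dist_comm]) (half q r hqr).1
    have b3 := ih _ hp _ hq2 _ hq1 _ hd' (half p q hpq).1 (half p r hpr).1 (by rwa [dist_comm])
    rw [hA p q r]
    simp only [dyaSum]
    rw [abs_le] at *
    constructor <;> linarith

lemma abs_mul_sub_mul_le_s12 {x y a b X e : ℝ} (hy : |y| ≤ X) (ha : |a| ≤ X)
    (hxa : |x - a| ≤ e) (hyb : |y - b| ≤ e) : |x * y - a * b| ≤ 2 * (X * e) := by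
  have h : x * y - a * b = (x - a) * y + a * (y - b) := by ring
  rw [h]
  refine (abs_add_le _ _).trans ?_
  rw [abs_mul, abs_mul]
  have h1 := mul_le_mul hxa hy (abs_nonneg _) ((abs_nonneg _).trans hxa)
  have h2 := mul_le_mul ha hyb (abs_nonneg _) ((abs_nonneg _).trans ha)
  linarith

lemma wedge_eq_edgeDet_mul (a b : E2 →L[ℝ] ℝ) (p q r : E2) :
    a (q - p) * b (r - p) - a (r - p) * b (q - p) =
      edgeDet p q r * (a (EuclideanSpace.single 0 1) * b (EuclideanSpace.single 1 1)
        - a (EuclideanSpace.single 1 1) * b (EuclideanSpace.single 0 1)) := by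
  have hdec (v : E2) : v = v 0 • EuclideanSpace.single 0 (1 : ℝ)
      + v 1 • EuclideanSpace.single 1 (1 : ℝ) := by
    ext i; fin_cases i <;> simp
  rw [hdec (q - p), hdec (r - p)]
  simp only [map_add, map_smul, smul_eq_mul, edgeDet, PiLp.sub_apply]
  ring

lemma abs_edgeDet_le {p q r : E2} {d : ℝ} (hpq : dist p q ≤ d) (hpr : dist p r ≤ d) :
    |edgeDet p q r| ≤ 2 * d ^ 2 := by
  have hd : 0 ≤ d := dist_nonneg.trans hpq
  have hc (x : E2) (hx : dist p x ≤ d) (i : Fin 2) : |x i - p i| ≤ d := by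
    have := PiLp.norm_apply_le (x - p) i
    rw [PiLp.sub_apply, Real.norm_eq_abs, ← dist_eq_norm, dist_comm] at this
    exact this.trans hx
  have hm (x y : ℝ) (hx : |x| ≤ d) (hy : |y| ≤ d) : |x * y| ≤ d * d := by
    rw [abs_mul]; gcongr
  have h1 := hm _ _ (hc q hpq 0) (hc r hpr 1)
  have h2 := hm _ _ (hc q hpq 1) (hc r hpr 0)
  rw [edgeDet]
  refine (abs_sub _ _).trans ?_
  linarith

/-- The signed integral over a small triangle is close to its one-point approximation. -/
lemma abs_triIntegral_sub_le {h : E2 → ℝ} (hh : Continuous h) {S : Set E2} (hS : Convex ℝ S)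
    {ε d : ℝ} {p q r : E2} (hp : p ∈ S) (hq : q ∈ S) (hr : r ∈ S) (hpq : dist p q ≤ d)
    (hpr : dist p r ≤ d) (hosc : ∀ x ∈ S, dist x p ≤ d → |h x - h p| ≤ ε) :
    |triIntegral h p q r - edgeDet p q r * (h p / 2)| ≤ ε * d ^ 2 := by
  have hd : 0 ≤ d := dist_nonneg.trans hpq
  have hint : IntegrableOn (fun x => h (triParam p q r x)) stdTriangle :=
    (hh.comp (continuous_triParam p q r)).continuousOn.integrableOn_compact isCompact_stdTriangle
  have hconst : ∫ _ in stdTriangle, h p = h p / 2 := by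
    rw [setIntegral_const, volume_real_stdTriangle, smul_eq_mul]; ring
  have hbound : ‖∫ x in stdTriangle, (h (triParam p q r x) - h p)‖ ≤ ε * (1 / 2) := by
    rw [← volume_real_stdTriangle]
    refine norm_setIntegral_le_of_norm_le_const isCompact_stdTriangle.measure_lt_top ?_
    intro x hx
    have hB : Convex ℝ (closedBall p d) := convex_closedBall p d
    exact hosc _ (triParam_mem_of_convex hS hp hq hr hx)
      (triParam_mem_of_convex hB (mem_closedBall_self hd) (by rwa [mem_closedBall'])
        (by rwa [mem_closedBall']) hx)
  have heq : triIntegral h p q r - edgeDet p q r * (h p / 2) =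
      edgeDet p q r * ∫ x in stdTriangle, (h (triParam p q r x) - h p) := by
    rw [integral_sub hint (continuous_const.continuousOn.integrableOn_compact
      isCompact_stdTriangle), hconst, triIntegral]
    ring
  rw [heq, abs_mul]
  have := mul_le_mul (abs_edgeDet_le hpq hpr) hbound (norm_nonneg _) (by positivity)
  rw [Real.norm_eq_abs] at this
  linarith

/-- The Jacobian determinant of `(g1, g2)`. -/
def jacobian (g1 g2 : E2 → ℝ) (x : E2) : ℝ :=
  fderiv ℝ g1 x (EuclideanSpace.single 0 1) * fderiv ℝ g2 x (EuclideanSpace.single 1 1)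
    - fderiv ℝ g1 x (EuclideanSpace.single 1 1) * fderiv ℝ g2 x (EuclideanSpace.single 0 1)

lemma continuous_jacobian {g1 g2 : E2 → ℝ} (hg1 : ContDiff ℝ 1 g1) (hg2 : ContDiff ℝ 1 g2) :
    Continuous (jacobian g1 g2) := by
  have h1 := hg1.continuous_fderiv one_ne_zero
  have h2 := hg2.continuous_fderiv one_ne_zero
  unfold jacobian
  fun_prop

/-- The Stratonovich germ on a small triangle is close to its one-point linearization. -/
lemma abs_strat_sub_le {f g1 g2 : E2 → ℝ} {M K ε d : ℝ} (hM : ∀ x, |f x| ≤ M)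
    (hg1 : ContDiff ℝ 1 g1) (hg2 : ContDiff ℝ 1 g2)
    (hK1 : ∀ x, ‖fderiv ℝ g1 x‖ ≤ K) (hK2 : ∀ x, ‖fderiv ℝ g2 x‖ ≤ K)
    {S : Set E2} (hS : Convex ℝ S) {p q r : E2} (hp : p ∈ S) (hq : q ∈ S) (hr : r ∈ S)
    (hpq : dist p q ≤ d) (hpr : dist p r ≤ d)
    (hosc : ∀ x ∈ S, dist x p ≤ d → |f x - f p| ≤ ε ∧ ‖fderiv ℝ g1 x - fderiv ℝ g1 p‖ ≤ ε ∧
      ‖fderiv ℝ g2 x - fderiv ℝ g2 p‖ ≤ ε) :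
    |strat f g1 g2 p q r - edgeDet p q r * (f p * jacobian g1 g2 p / 2)| ≤
      (K ^ 2 + 2 * M * K) * ε * d ^ 2 := by
  have hd : 0 ≤ d := dist_nonneg.trans hpq
  have hε : 0 ≤ ε := (abs_nonneg _).trans (hosc p hp (by simpa using hd)).1
  have hK : 0 ≤ K := (norm_nonneg _).trans (hK1 p)
  have hM0 : 0 ≤ M := (abs_nonneg _).trans (hM p)
  have hincr (g : E2 → ℝ) (hg : ContDiff ℝ 1 g) (hgK : ∀ x, ‖fderiv ℝ g x‖ ≤ K)
      (hgosc : ∀ x ∈ S, dist x p ≤ d → ‖fderiv ℝ g x - fderiv ℝ g p‖ ≤ ε) (x : E2) (hx : x ∈ S)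
      (hxd : dist p x ≤ d) : |g x - g p| ≤ K * d ∧ |fderiv ℝ g p (x - p)| ≤ K * d ∧
        |g x - g p - fderiv ℝ g p (x - p)| ≤ ε * d := by
    have hdiff := hg.differentiable one_ne_zero
    have hn : ‖x - p‖ ≤ d := by rwa [← dist_eq_norm, dist_comm]
    refine ⟨?_, ?_, ?_⟩
    · refine (convex_univ.norm_image_sub_le_of_norm_fderiv_le (𝕜 := ℝ) (fun y _ => hdiff y)
        (fun y _ => hgK y) (Set.mem_univ p) (Set.mem_univ x)).trans ?_
      gcongr
    · refine ((fderiv ℝ g p).le_opNorm (x - p)).trans ?_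
      exact mul_le_mul (hgK p) hn (norm_nonneg _) hK
    · refine ((hS.inter (convex_closedBall p d)).norm_image_sub_le_of_norm_fderiv_le' (𝕜 := ℝ)
        (fun y _ => hdiff y) (fun y hy => hgosc y hy.1 hy.2) ⟨hp, mem_closedBall_self hd⟩
        ⟨hx, mem_closedBall'.2 hxd⟩).trans ?_
      gcongr
  have h1 := hincr g1 hg1 hK1 fun x hx hxd => (hosc x hx hxd).2.1
  have h2 := hincr g2 hg2 hK2 fun x hx hxd => (hosc x hx hxd).2.2
  obtain ⟨a1, a2, a3⟩ := h1 q hq hpq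
  obtain ⟨b1, b2, b3⟩ := h1 r hr hpr
  obtain ⟨c1, c2, c3⟩ := h2 q hq hpq
  obtain ⟨e1, e2, e3⟩ := h2 r hr hpr
  have hW := wedge_eq_edgeDet_mul (fderiv ℝ g1 p) (fderiv ℝ g2 p) p q r
  set W := fderiv ℝ g1 p (q - p) * fderiv ℝ g2 p (r - p)
    - fderiv ℝ g1 p (r - p) * fderiv ℝ g2 p (q - p) with hWdef
  set V := (g1 q - g1 p) * (g2 r - g2 p) - (g1 r - g1 p) * (g2 q - g2 p) with hV
  have hVW : |V - W| ≤ 4 * (K * d * (ε * d)) := by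
    have t1 := abs_mul_sub_mul_le_s12 e1 a2 a3 e3
    have t2 := abs_mul_sub_mul_le_s12 c1 b2 b3 c3
    rw [hV, hWdef, sub_sub_sub_comm]
    exact (abs_sub _ _).trans (by linarith)
  have hVb : |V| ≤ 2 * (K * d) ^ 2 := by
    have t (x y : ℝ) (hx : |x| ≤ K * d) (hy : |y| ≤ K * d) : |x * y| ≤ K * d * (K * d) := by
      rw [abs_mul]; exact mul_le_mul hx hy (abs_nonneg _) (by positivity)
    exact (abs_sub _ _).trans (by linarith [t _ _ a1 e1, t _ _ b1 c1])
  have hfavg : |(f p + f q + f r) / 3 - f p| ≤ ε := by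
    have fq := (hosc q hq (by rwa [dist_comm])).1
    have fr := (hosc r hr (by rwa [dist_comm])).1
    rw [abs_le] at *
    constructor <;> linarith
  have heq : strat f g1 g2 p q r - edgeDet p q r * (f p * jacobian g1 g2 p / 2) =
      (1 / 2) * ((((f p + f q + f r) / 3 - f p) * V) + f p * (V - W)) := by
    rw [hW, strat, ← hV, jacobian]
    ring
  have u1 : |((f p + f q + f r) / 3 - f p) * V| ≤ ε * (2 * (K * d) ^ 2) := by
    rw [abs_mul]; exact mul_le_mul hfavg hVb (abs_nonneg _) hε
  have u2 : |f p * (V - W)| ≤ M * (4 * (K * d * (ε * d))) := by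
    rw [abs_mul]; exact mul_le_mul (hM p) hVW (abs_nonneg _) hM0
  rw [heq, abs_mul, abs_of_pos (by norm_num : (0 : ℝ) < 1 / 2)]
  have := abs_add_le (((f p + f q + f r) / 3 - f p) * V) (f p * (V - W))
  linarith

lemma continuous_of_holder {α Hf : ℝ} (hα : 0 < α) {f : E2 → ℝ}
    (hf : ∀ x y, |f x - f y| ≤ Hf * dist x y ^ α) : Continuous f := by
  refine continuous_iff_continuousAt.2 fun y => ?_
  refine tendsto_iff_dist_tendsto_zero.2 ?_
  have hc : Continuous fun x : E2 => Hf * dist x y ^ α :=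
    continuous_const.mul ((continuous_id.dist continuous_const).rpow_const fun _ => Or.inr hα.le)
  have ht := hc.tendsto y
  simp only [dist_self, Real.zero_rpow hα.ne', mul_zero] at ht
  exact squeeze_zero (fun _ => dist_nonneg) (fun x => hf x y) ht

lemma exists_modulus {F : Type*} [NormedAddCommGroup F] {S : Set E2} (hS : IsCompact S)
    {φ : E2 → F} (hφ : Continuous φ) {ε : ℝ} (hε : 0 < ε) :
    ∃ δ > 0, ∀ x ∈ S, ∀ y ∈ S, dist x y ≤ δ → ‖φ x - φ y‖ ≤ ε := by
  obtain ⟨δ, hδ, h⟩ := Metric.uniformContinuousOn_iff_le.1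
    (hS.uniformContinuousOn_of_continuous hφ.continuousOn) ε hε
  exact ⟨δ, hδ, fun x hx y hy hxy => by simpa [dist_eq_norm] using h x hx y hy hxy⟩

/-- for `g¹, g²` of class `C¹` with bounded derivatives, the dyadic Stratonovich
sums converge to the (signed) classical integral over the triangle. -/
theorem stmt_12 (α : ℝ) (hα : α ∈ Set.Ioc (0:ℝ) 1)
    (f g1 g2 : E2 → ℝ) (M Hf K : ℝ)
    (hM : ∀ x, |f x| ≤ M)
    (hf : ∀ x y, |f x - f y| ≤ Hf * dist x y ^ α)
    (hg1 : ContDiff ℝ 1 g1) (hg2 : ContDiff ℝ 1 g2)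
    (hK1 : ∀ x, ‖fderiv ℝ g1 x‖ ≤ K) (hK2 : ∀ x, ‖fderiv ℝ g2 x‖ ≤ K)
    (p q r : E2) :
    Tendsto (fun n => dyaSum (strat f g1 g2) n p q r) atTop
      (nhds
        (Real.sign ((q 0 - p 0) * (r 1 - p 1) - (q 1 - p 1) * (r 0 - p 0)) *
          ∫ x in convexHull ℝ ({p, q, r} : Set E2),
            f x * (fderiv ℝ g1 x (EuclideanSpace.single 0 1)
                      * fderiv ℝ g2 x (EuclideanSpace.single 1 1)
                   - fderiv ℝ g1 x (EuclideanSpace.single 1 1)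
                      * fderiv ℝ g2 x (EuclideanSpace.single 0 1)))) := by
  have hfc : Continuous f := continuous_of_holder hα.1 hf
  let h : E2 → ℝ := fun x => f x * jacobian g1 g2 x
  have hhc : Continuous h := hfc.mul (continuous_jacobian hg1 hg2)
  change Tendsto _ _ (nhds (Real.sign (edgeDet p q r) *
    ∫ x in convexHull ℝ ({p, q, r} : Set E2), h x))
  rw [sign_mul_integral_convexHull]
  let S : Set E2 := convexHull ℝ {p, q, r}
  have hScompact : IsCompact S := (Set.toFinite {p, q, r}).isCompact_convexHull ℝ
  have hSconvex : Convex ℝ S := convex_convexHull ℝ _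
  have hpS : p ∈ S := subset_convexHull ℝ _ (by simp)
  have hqS : q ∈ S := subset_convexHull ℝ _ (by simp)
  have hrS : r ∈ S := subset_convexHull ℝ _ (by simp)
  have hK : 0 ≤ K := (norm_nonneg _).trans (hK1 p)
  have hM0 : 0 ≤ M := (abs_nonneg _).trans (hM p)
  let D : ℝ := max (dist p q) (max (dist p r) (dist q r))
  let C : ℝ := K ^ 2 + 2 * M * K + 1
  have hC : 0 < C := by positivity
  rw [Metric.tendsto_atTop]
  intro η hη
  let ε : ℝ := η / (2 * (C * (D ^ 2 + 1)))
  have hε : 0 < ε := by positivity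
  obtain ⟨δ₀, hδ₀, h₀⟩ := exists_modulus hScompact hfc hε
  obtain ⟨δ₁, hδ₁, h₁⟩ := exists_modulus hScompact (hg1.continuous_fderiv one_ne_zero) hε
  obtain ⟨δ₂, hδ₂, h₂⟩ := exists_modulus hScompact (hg2.continuous_fderiv one_ne_zero) hε
  obtain ⟨δ₃, hδ₃, h₃⟩ := exists_modulus hScompact hhc hε
  let δ : ℝ := min (min δ₀ δ₁) (min δ₂ δ₃)
  have hδ : 0 < δ := lt_min (lt_min hδ₀ hδ₁) (lt_min hδ₂ hδ₃)
  have hloc : ∀ p ∈ S, ∀ q ∈ S, ∀ r ∈ S, ∀ d ≤ δ, dist p q ≤ d → dist p r ≤ d → dist q r ≤ d →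
      |strat f g1 g2 p q r - triIntegral h p q r| ≤ C * ε * d ^ 2 := by
    intro p hp q hq r hr d hd hpq hpr _
    have hd₀ : d ≤ δ₀ := hd.trans ((min_le_left _ _).trans (min_le_left _ _))
    have hd₁ : d ≤ δ₁ := hd.trans ((min_le_left _ _).trans (min_le_right _ _))
    have hd₂ : d ≤ δ₂ := hd.trans ((min_le_right _ _).trans (min_le_left _ _))
    have hd₃ : d ≤ δ₃ := hd.trans ((min_le_right _ _).trans (min_le_right _ _))
    have hs := abs_strat_sub_le hM hg1 hg2 hK1 hK2 hSconvex hp hq hr hpq hpr fun x hx hxd =>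
      ⟨h₀ x hx p hp (hxd.trans hd₀), h₁ x hx p hp (hxd.trans hd₁), h₂ x hx p hp (hxd.trans hd₂)⟩
    have ht := abs_triIntegral_sub_le hhc hSconvex hp hq hr hpq hpr fun x hx hxd =>
      h₃ x hx p hp (hxd.trans hd₃)
    rw [abs_sub_comm] at ht
    refine (abs_sub_le _ (edgeDet p q r * (h p / 2)) _).trans ((add_le_add hs ht).trans_eq ?_)
    simp only [C]
    ring
  obtain ⟨N, hN⟩ := pow_unbounded_of_one_lt (D / δ) (one_lt_two : (1 : ℝ) < 2)
  refine ⟨N, fun n hn => ?_⟩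
  have hDn : D ≤ 2 ^ n * δ := by
    rw [div_lt_iff₀ hδ] at hN
    have : (2 : ℝ) ^ N ≤ 2 ^ n := pow_le_pow_right₀ one_le_two hn
    nlinarith
  rw [Real.dist_eq]
  refine (abs_dyaSum_sub_le hSconvex (triIntegral_subdivision h hhc) hloc n p hpS q hqS r hrS D hDn
    (le_max_left _ _) ((le_max_left _ _).trans (le_max_right _ _))
    ((le_max_right _ _).trans (le_max_right _ _))).trans_lt ?_
  have hεC : C * ε * (D ^ 2 + 1) = η / 2 := by
    simp only [ε]
    field_simp
  nlinarith [mul_pos hC hε]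
end
end

section
/- Let α, β₁, β₂, β₃ ∈ (0,1] with α + β₁ + β₂ > 2, let f : ℝ² → ℝ be bounded and α-Hölder, let gⁱ : ℝ² → ℝ be βᵢ-Hölder for i = 1, 2, and let h : ℝ² → ℝ be β₃-Hölder. Suppose there are bounded functions a¹, a² : ℝ² → ℝ, exponents γ₁, γ₂ > 1 − β₃ and a constant C > 0 such that |δgⁱ_{pq} − aⁱ(p)·δh_{pq}| ≤ C·|p − q|^{1+γᵢ} for all p, q ∈ ℝ² and i = 1, 2. Then lim_{n→∞} strat^n_{pqr} = 0 for all p, q, r ∈ ℝ². -/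
open Filter Metric

noncomputable section

/-- The midpoints of two sides with a common endpoint are half as far apart as the other
endpoints. -/
lemma dist_midpoint_midpoint_right (x y z : E2) :
    dist (midpoint ℝ x z) (midpoint ℝ y z) = dist x y / 2 := by
  have key : midpoint ℝ x z - midpoint ℝ y z = (2⁻¹ : ℝ) • (x - y) := by
    simp only [midpoint_eq_smul_add, invOf_eq_inv]
    module
  rw [dist_eq_norm, key, norm_smul, dist_eq_norm]
  norm_num
  ring

/-- A scale-dependent bound on a 2-germ yields a bound on its dyadic sums. -/
lemma abs_dyaSum_le {ω : E2 → E2 → E2 → ℝ} {φ : ℝ → ℝ}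
    (hω : ∀ (d : ℝ) (p q r : E2), dist p q ≤ d → dist p r ≤ d → dist q r ≤ d →
      |ω p q r| ≤ φ d) (n : ℕ) :
    ∀ (d : ℝ) (p q r : E2), dist p q ≤ d → dist p r ≤ d → dist q r ≤ d →
      |dyaSum ω n p q r| ≤ 4 ^ n * φ (d / 2 ^ n) := by
  induction n with
  | zero => simpa [dyaSum] using hω
  | succ n ih =>
    intro d p q r hpq hpr hqr
    have ha : dist (midpoint ℝ p r) (midpoint ℝ q r) ≤ d / 2 := by
      rw [dist_midpoint_midpoint_right]; linarith
    have hb : dist (midpoint ℝ p q) (midpoint ℝ q r) ≤ d / 2 := by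
      rw [midpoint_comm q r, dist_midpoint_midpoint_right]; linarith
    have hc : dist (midpoint ℝ p q) (midpoint ℝ p r) ≤ d / 2 := by
      rw [midpoint_comm p q, midpoint_comm p r, dist_midpoint_midpoint_right]; linarith
    have hleft : ∀ x y : E2, dist x y ≤ d → dist x (midpoint ℝ x y) ≤ d / 2 := by
      intro x y hxy
      rw [dist_left_midpoint]
      norm_num
      linarith
    have hright : ∀ x y : E2, dist x y ≤ d → dist (midpoint ℝ x y) y ≤ d / 2 := by
      intro x y hxy
      rw [dist_midpoint_right]
      norm_num
      linarith
    have hq : dist q (midpoint ℝ q r) ≤ d / 2 := hleft q r hqr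
    have h₀ := ih (d / 2) (midpoint ℝ q r) (midpoint ℝ p r) (midpoint ℝ p q)
      (by rwa [dist_comm]) (by rwa [dist_comm]) (by rwa [dist_comm])
    have h₁ := ih (d / 2) (midpoint ℝ p r) (midpoint ℝ q r) r ha (hright p r hpr)
      (hright q r hqr)
    have h₂ := ih (d / 2) (midpoint ℝ p q) q (midpoint ℝ q r) (hright p q hpq) hb hq
    have h₃ := ih (d / 2) p (midpoint ℝ p q) (midpoint ℝ p r) (hleft p q hpq)
      (hleft p r hpr) hc
    have hd : d / 2 / 2 ^ n = d / 2 ^ (n + 1) := by rw [pow_succ']; field_simp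
    rw [hd, abs_le] at h₀ h₁ h₂ h₃
    rw [dyaSum, abs_le, pow_succ]
    constructor <;> linarith

/-- Powers of total order larger than two beat the number of dyadic triangles. -/
lemma tendsto_four_pow_mul_rpow_mul_rpow {a b d : ℝ} (hd : 0 ≤ d) (hab : 2 < a + b) :
    Tendsto (fun n : ℕ => (4 : ℝ) ^ n * ((d / 2 ^ n) ^ a * (d / 2 ^ n) ^ b)) atTop (nhds 0) := by
  have h4 : (4 : ℝ) < 2 ^ a * 2 ^ b := by
    rw [← Real.rpow_add two_pos]
    calc (4 : ℝ) = 2 ^ (2 : ℝ) := by norm_num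
      _ < 2 ^ (a + b) := Real.rpow_lt_rpow_of_exponent_lt one_lt_two hab
  have hlim := (tendsto_pow_atTop_nhds_zero_of_lt_one (r := (4 : ℝ) / (2 ^ a * 2 ^ b))
    (by positivity) ((div_lt_one (by positivity)).2 h4)).const_mul (d ^ a * d ^ b)
  rw [mul_zero] at hlim
  refine hlim.congr fun n => ?_
  have hpow : ∀ c : ℝ, ((2 : ℝ) ^ n) ^ c = (2 ^ c) ^ n := fun c => by
    rw [← Real.rpow_natCast, ← Real.rpow_natCast, ← Real.rpow_mul zero_le_two,
      ← Real.rpow_mul zero_le_two, mul_comm]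
  rw [Real.div_rpow hd (by positivity), Real.div_rpow hd (by positivity), hpow, hpow, div_pow,
    mul_pow]
  field_simp

/-- If both increments are multiples of the same one up to remainders, their determinant is
controlled by the remainders. -/
lemma abs_det_le {x₁ x₂ y₁ y₂ a₁ a₂ X Y A B K₁ K₂ : ℝ} (ha₁ : |a₁| ≤ A) (ha₂ : |a₂| ≤ A)
    (hX : |X| ≤ B) (hY : |Y| ≤ B) (hx₁ : |x₁ - a₁ * X| ≤ K₁) (hy₁ : |y₁ - a₁ * Y| ≤ K₁)
    (hx₂ : |x₂ - a₂ * X| ≤ K₂) (hy₂ : |y₂ - a₂ * Y| ≤ K₂) :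
    |x₁ * y₂ - y₁ * x₂| ≤ 2 * (A * B * K₁ + A * B * K₂ + K₁ * K₂) := by
  have bound : ∀ {u v U V : ℝ}, |u| ≤ U → |v| ≤ V → |u * v| ≤ U * V := fun hu hv => by
    rw [abs_mul]
    exact mul_le_mul hu hv (abs_nonneg _) ((abs_nonneg _).trans hu)
  have e₁ := abs_le.1 (bound (bound ha₁ hX) hy₂)
  have e₂ := abs_le.1 (bound (bound ha₂ hY) hx₁)
  have e₃ := abs_le.1 (bound hx₁ hy₂)
  have e₄ := abs_le.1 (bound (bound ha₁ hY) hx₂)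
  have e₅ := abs_le.1 (bound (bound ha₂ hX) hy₁)
  have e₆ := abs_le.1 (bound hy₁ hx₂)
  rw [abs_le]
  constructor <;> linarith

/-- if both `g¹` and `g²` are suitably `h`-differentiable, then the dyadic
Stratonovich sums converge to zero. -/
theorem stmt_13 (α β₁ β₂ β₃ : ℝ) (hα : α ∈ Set.Ioc (0:ℝ) 1) (hβ₁ : β₁ ∈ Set.Ioc (0:ℝ) 1)
    (hβ₂ : β₂ ∈ Set.Ioc (0:ℝ) 1) (hβ₃ : β₃ ∈ Set.Ioc (0:ℝ) 1) (hsum : 2 < α + β₁ + β₂)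
    (f g1 g2 h : E2 → ℝ) (M Hf H1 H2 H3 : ℝ)
    (hM0 : 0 ≤ M) (hHf0 : 0 ≤ Hf) (hH10 : 0 ≤ H1) (hH20 : 0 ≤ H2) (hH30 : 0 ≤ H3)
    (hM : ∀ x, |f x| ≤ M)
    (hf : ∀ x y, |f x - f y| ≤ Hf * dist x y ^ α)
    (hg1 : ∀ x y, |g1 x - g1 y| ≤ H1 * dist x y ^ β₁)
    (hg2 : ∀ x y, |g2 x - g2 y| ≤ H2 * dist x y ^ β₂)
    (hh : ∀ x y, |h x - h y| ≤ H3 * dist x y ^ β₃)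
    (a1 a2 : E2 → ℝ) (A : ℝ) (ha1 : ∀ x, |a1 x| ≤ A) (ha2 : ∀ x, |a2 x| ≤ A)
    (γ₁ γ₂ : ℝ) (hγ₁ : 1 - β₃ < γ₁) (hγ₂ : 1 - β₃ < γ₂)
    (C : ℝ) (hC : 0 < C)
    (hdiff1 : ∀ p q : E2, |(g1 q - g1 p) - a1 p * (h q - h p)| ≤ C * dist p q ^ (1 + γ₁))
    (hdiff2 : ∀ p q : E2, |(g2 q - g2 p) - a2 p * (h q - h p)| ≤ C * dist p q ^ (1 + γ₂))
    (p q r : E2) :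
    Tendsto (fun n => dyaSum (strat f g1 g2) n p q r) atTop (nhds 0) := by
  let φ : ℝ → ℝ := fun d =>
    M * A * H3 * C * (d ^ β₃ * d ^ (1 + γ₁)) + M * A * H3 * C * (d ^ β₃ * d ^ (1 + γ₂))
      + M * C ^ 2 * (d ^ (1 + γ₁) * d ^ (1 + γ₂))
  have hβ₃1 := hβ₃.2
  have hgerm : ∀ (d : ℝ) (p q r : E2), dist p q ≤ d → dist p r ≤ d → dist q r ≤ d →
      |strat f g1 g2 p q r| ≤ φ d := by
    intro d p q r hpq hpr _
    have mono : ∀ {K e : ℝ} {x : E2}, 0 ≤ K → 0 ≤ e → dist p x ≤ d →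
        K * dist p x ^ e ≤ K * d ^ e := fun hK he hx =>
      mul_le_mul_of_nonneg_left (Real.rpow_le_rpow dist_nonneg hx he) hK
    have hX : ∀ x, dist p x ≤ d → |h x - h p| ≤ H3 * d ^ β₃ := fun x hx => by
      rw [abs_sub_comm]
      exact (hh p x).trans (mono hH30 hβ₃.1.le hx)
    have hR1 : ∀ x, dist p x ≤ d → |(g1 x - g1 p) - a1 p * (h x - h p)| ≤ C * d ^ (1 + γ₁) :=
      fun x hx => (hdiff1 p x).trans (mono hC.le (by linarith) hx)
    have hR2 : ∀ x, dist p x ≤ d → |(g2 x - g2 p) - a2 p * (h x - h p)| ≤ C * d ^ (1 + γ₂) :=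
      fun x hx => (hdiff2 p x).trans (mono hC.le (by linarith) hx)
    have hdet := abs_det_le (ha1 p) (ha2 p) (hX q hpq) (hX r hpr) (hR1 q hpq) (hR1 r hpr)
      (hR2 q hpq) (hR2 r hpr)
    have hcoef : |(1 / 2) * ((f p + f q + f r) / 3)| ≤ M / 2 := by
      have ep := abs_le.1 (hM p)
      have eq := abs_le.1 (hM q)
      have er := abs_le.1 (hM r)
      rw [abs_le]
      constructor <;> linarith
    rw [strat, abs_mul]
    refine (mul_le_mul hcoef hdet (abs_nonneg _) (by linarith)).trans_eq ?_
    simp only [φ]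
    ring
  let d := max (dist p q) (max (dist p r) (dist q r))
  have hd : 0 ≤ d := dist_nonneg.trans (le_max_left _ _)
  refine squeeze_zero_norm (fun n => abs_dyaSum_le hgerm n d p q r (le_max_left _ _)
    ((le_max_left _ _).trans (le_max_right _ _))
    ((le_max_right _ _).trans (le_max_right _ _))) ?_
  have l₁ := (tendsto_four_pow_mul_rpow_mul_rpow (a := β₃) (b := 1 + γ₁) hd
    (by linarith)).const_mul (M * A * H3 * C)
  have l₂ := (tendsto_four_pow_mul_rpow_mul_rpow (a := β₃) (b := 1 + γ₂) hd
    (by linarith)).const_mul (M * A * H3 * C)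
  have l₃ := (tendsto_four_pow_mul_rpow_mul_rpow (a := 1 + γ₁) (b := 1 + γ₂) hd
    (by linarith)).const_mul (M * C ^ 2)
  have l := (l₁.add l₂).add l₃
  simp only [mul_zero, add_zero] at l
  refine l.congr fun n => ?_
  simp only [φ]
  ring
end
end

section
/- Let α, β₁, β₂ ∈ (0,1] with α + β₁ + β₂ > 2, let f : ℝ² → ℝ be bounded and α-Hölder, and let gⁱ : ℝ² → ℝ be βᵢ-Hölder for i = 1, 2. Let S^n and strat^n be the side correctors and dyadic sums of the Stratonovich germ strat of (f, g¹, g²), and let S_{pq} := lim_{n→∞} S^n_{pq} and V_{pqr} := lim_{n→∞} strat^n_{pqr} (these limits exist). Then there is a constant C depending only on α, β₁, β₂ such that for all n ∈ ℕ and all p, q, r ∈ ℝ², |strat^n_{pqr} − V_{pqr} − (δ(S^n − S))_{pqr}| ≤ C·‖f‖_α·[g¹]_{β₁}·[g²]_{β₂}·diam([pqr])^{α+β₁+β₂}·2^{n(2−α−β₁−β₂)}, where (δ(S^n − S))_{pqr} := (S^n − S)_{qr} − (S^n − S)_{pr} + (S^n − S)_{pq}. -/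
open Filter Metric

noncomputable section

theorem strat_bound {f g1 g2 : E2 → ℝ} {α β₁ β₂ F H1 H2 d : ℝ} (hd : 0 ≤ d)
    (hβ₁ : 0 ≤ β₁) (hβ₂ : 0 ≤ β₂) (hF : 0 ≤ F) (hH1 : 0 ≤ H1) (hH2 : 0 ≤ H2)
    (h1 : ∀ x y, |g1 x - g1 y| ≤ H1 * dist x y ^ β₁)
    (h2 : ∀ x y, |g2 x - g2 y| ≤ H2 * dist x y ^ β₂)
    {p q r : E2} (hfp : |f p| ≤ F * d ^ α) (hfq : |f q| ≤ F * d ^ α) (hfr : |f r| ≤ F * d ^ α)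
    (hpq : dist q p ≤ d) (hpr : dist r p ≤ d) :
    |strat f g1 g2 p q r| ≤ F * H1 * H2 * (d ^ α * d ^ β₁ * d ^ β₂) := by
  have g1_bound : ∀ x, dist x p ≤ d → |g1 x - g1 p| ≤ H1 * d ^ β₁ := fun x hx =>
    (h1 x p).trans (by gcongr)
  have g2_bound : ∀ x, dist x p ≤ d → |g2 x - g2 p| ≤ H2 * d ^ β₂ := fun x hx =>
    (h2 x p).trans (by gcongr)
  have mean_bound : |(f p + f q + f r) / 3| ≤ F * d ^ α := by
    rw [abs_le] at *
    constructor <;> linarith [hfp.1, hfp.2, hfq.1, hfq.2, hfr.1, hfr.2]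
  have det_bound : |(g1 q - g1 p) * (g2 r - g2 p) - (g1 r - g1 p) * (g2 q - g2 p)|
      ≤ 2 * ((H1 * d ^ β₁) * (H2 * d ^ β₂)) := by
    refine (abs_sub _ _).trans ?_
    rw [abs_mul, abs_mul, two_mul]
    gcongr
    exacts [g1_bound q hpq, g2_bound r hpr, g1_bound r hpr, g2_bound q hpq]
  unfold strat
  rw [abs_mul, abs_mul, abs_of_pos (by norm_num : (0 : ℝ) < 1 / 2)]
  calc 1 / 2 * |(f p + f q + f r) / 3| *
        |(g1 q - g1 p) * (g2 r - g2 p) - (g1 r - g1 p) * (g2 q - g2 p)|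
      ≤ 1 / 2 * (F * d ^ α) * (2 * ((H1 * d ^ β₁) * (H2 * d ^ β₂))) := by gcongr
    _ = F * H1 * H2 * (d ^ α * d ^ β₁ * d ^ β₂) := by ring

theorem sideCorr_strat_swap (f g1 g2 : E2 → ℝ) (n : ℕ) (p q : E2) :
    sideCorr (strat f g1 g2) n q p = -sideCorr (strat f g1 g2) n p q := by
  induction n generalizing p q with
  | zero => simp [sideCorr]
  | succ n ih =>
    simp only [sideCorr]
    rw [midpoint_comm (R := ℝ) q p, ih p, ih _ q]
    simp only [strat]
    ring

theorem mul_half_rpow (k γ : ℝ) {d : ℝ} (hd : 0 ≤ d) :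
    2 ^ k * (d / 2) ^ γ = (2 : ℝ) ^ (k - γ) * d ^ γ := by
  rw [Real.div_rpow hd zero_le_two, Real.rpow_sub two_pos]
  ring

theorem sideCorr_increment_bound {ω : E2 → E2 → E2 → ℝ} {K b : ℝ}
    (hω : ∀ p q, |ω p (midpoint ℝ p q) q| ≤ K * dist p q ^ b) (n : ℕ) (p q : E2) :
    |sideCorr ω (n + 1) p q - sideCorr ω n p q| ≤ K * dist p q ^ b * ((2 : ℝ) ^ (1 - b)) ^ n := by
  induction n generalizing p q with
  | zero => simpa [sideCorr] using hω p q
  | succ n ih =>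
    have left_half := ih p (midpoint ℝ p q)
    have right_half := ih (midpoint ℝ p q) q
    have dist_left : dist p (midpoint ℝ p q) = dist p q / 2 := by
      rw [dist_left_midpoint]; norm_num; ring
    have dist_right : dist (midpoint ℝ p q) q = dist p q / 2 := by
      rw [dist_midpoint_right]; norm_num; ring
    have scaling := mul_half_rpow 1 b (dist_nonneg (x := p) (y := q))
    rw [Real.rpow_one] at scaling
    rw [dist_left] at left_half
    rw [dist_right] at right_half
    calc |sideCorr ω (n + 1 + 1) p q - sideCorr ω (n + 1) p q|
        = |(sideCorr ω (n + 1) p (midpoint ℝ p q) - sideCorr ω n p (midpoint ℝ p q))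
          + (sideCorr ω (n + 1) (midpoint ℝ p q) q - sideCorr ω n (midpoint ℝ p q) q)| := by
          congr 1
          rw [show sideCorr ω (n + 1 + 1) p q = ω p (midpoint ℝ p q) q
              + sideCorr ω (n + 1) p (midpoint ℝ p q)
              + sideCorr ω (n + 1) (midpoint ℝ p q) q from rfl,
            show sideCorr ω (n + 1) p q = ω p (midpoint ℝ p q) q
              + sideCorr ω n p (midpoint ℝ p q) + sideCorr ω n (midpoint ℝ p q) q from rfl]
          ring
      _ ≤ _ := abs_add_le _ _
      _ ≤ K * (2 * (dist p q / 2) ^ b) * ((2 : ℝ) ^ (1 - b)) ^ n := by linarith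
      _ = _ := by rw [scaling]; ring

/-- Dyadic sums from which the coboundary of the side correctors has been subtracted. -/
def corrSum (ω : E2 → E2 → E2 → ℝ) (n : ℕ) (p q r : E2) : ℝ :=
  dyaSum ω n p q r - (sideCorr ω n q r - sideCorr ω n p r + sideCorr ω n p q)

theorem corrSum_strat_succ (f g1 g2 : E2 → ℝ) (n : ℕ) (p q r : E2) :
    corrSum (strat f g1 g2) (n + 1) p q r =
      corrSum (strat f g1 g2) n (midpoint ℝ q r) (midpoint ℝ p r) (midpoint ℝ p q)
      + corrSum (strat f g1 g2) n (midpoint ℝ p r) (midpoint ℝ q r) r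
      + corrSum (strat f g1 g2) n (midpoint ℝ p q) q (midpoint ℝ q r)
      + corrSum (strat f g1 g2) n p (midpoint ℝ p q) (midpoint ℝ p r)
      - (strat f g1 g2 q (midpoint ℝ q r) r - strat f g1 g2 p (midpoint ℝ p r) r
        + strat f g1 g2 p (midpoint ℝ p q) q) := by
  simp only [corrSum, dyaSum, sideCorr]
  rw [sideCorr_strat_swap f g1 g2 n (midpoint ℝ p r) (midpoint ℝ q r),
    sideCorr_strat_swap f g1 g2 n (midpoint ℝ p q) (midpoint ℝ p r),
    sideCorr_strat_swap f g1 g2 n (midpoint ℝ p q) (midpoint ℝ q r)]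
  ring

theorem corrSum_strat_one_sub_zero_bound {f g1 g2 : E2 → ℝ} {α β₁ β₂ F H1 H2 d : ℝ}
    (hα : 0 ≤ α) (hβ₁ : 0 ≤ β₁) (hβ₂ : 0 ≤ β₂) (hF : 0 ≤ F) (hH1 : 0 ≤ H1) (hH2 : 0 ≤ H2)
    (hf : ∀ x y, |f x - f y| ≤ F * dist x y ^ α)
    (h1 : ∀ x y, |g1 x - g1 y| ≤ H1 * dist x y ^ β₁)
    (h2 : ∀ x y, |g2 x - g2 y| ≤ H2 * dist x y ^ β₂)
    {p q r : E2} (hd : Metric.diam ({p, q, r} : Set E2) ≤ d) :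
    |corrSum (strat f g1 g2) 1 p q r - corrSum (strat f g1 g2) 0 p q r| ≤
      8 * (F * H1 * H2) * (d ^ α * d ^ β₁ * d ^ β₂) := by
  have d_nonneg : 0 ≤ d := Metric.diam_nonneg.trans hd
  have hull_bounded : Bornology.IsBounded (convexHull ℝ ({p, q, r} : Set E2)) :=
    isBounded_convexHull.2 (Set.toFinite _).isBounded
  have dist_le : ∀ x ∈ convexHull ℝ ({p, q, r} : Set E2),
      ∀ y ∈ convexHull ℝ ({p, q, r} : Set E2), dist x y ≤ d := fun x hx y hy =>
    (Metric.dist_le_diam_of_mem hull_bounded hx hy).trans ((convexHull_diam _).trans_le hd)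
  have hp : p ∈ convexHull ℝ ({p, q, r} : Set E2) := subset_convexHull _ _ (by simp)
  have hq : q ∈ convexHull ℝ ({p, q, r} : Set E2) := subset_convexHull _ _ (by simp)
  have hr : r ∈ convexHull ℝ ({p, q, r} : Set E2) := subset_convexHull _ _ (by simp)
  have hpq := (convex_convexHull ℝ ({p, q, r} : Set E2)).midpoint_mem hp hq
  have hpr := (convex_convexHull ℝ ({p, q, r} : Set E2)).midpoint_mem hp hr
  have hqr := (convex_convexHull ℝ ({p, q, r} : Set E2)).midpoint_mem hq hr
  have f_bound : ∀ x ∈ convexHull ℝ ({p, q, r} : Set E2), |f x - f p| ≤ F * d ^ α :=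
    fun x hx => (hf x p).trans (by gcongr; exact dist_le x hx p hp)
  have germ_bound : ∀ x ∈ convexHull ℝ ({p, q, r} : Set E2),
      ∀ y ∈ convexHull ℝ ({p, q, r} : Set E2), ∀ z ∈ convexHull ℝ ({p, q, r} : Set E2),
      |strat (fun u => f u - f p) g1 g2 x y z| ≤ F * H1 * H2 * (d ^ α * d ^ β₁ * d ^ β₂) :=
    fun x hx y hy z hz => strat_bound d_nonneg hβ₁ hβ₂ hF hH1 hH2 h1 h2
      (f_bound x hx) (f_bound y hy) (f_bound z hz) (dist_le y hy x hx) (dist_le z hz x hx)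
  -- The germ of a constant integrand has vanishing increment, so `f` may be centred at `p`.
  have centred : corrSum (strat f g1 g2) 1 p q r - corrSum (strat f g1 g2) 0 p q r =
      corrSum (strat (fun u => f u - f p) g1 g2) 1 p q r
        - corrSum (strat (fun u => f u - f p) g1 g2) 0 p q r := by
    simp only [corrSum, dyaSum, sideCorr, strat]
    ring
  rw [centred]
  simp only [corrSum, dyaSum, sideCorr]
  have bounds := fun x hx y hy z hz => abs_le.1 (germ_bound x hx y hy z hz)
  have b₁ := bounds _ hqr _ hpr _ hpq
  have b₂ := bounds _ hpr _ hqr _ hr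
  have b₃ := bounds _ hpq _ hq _ hqr
  have b₄ := bounds _ hp _ hpq _ hpr
  have b₅ := bounds _ hp _ hq _ hr
  have b₆ := bounds _ hq _ hqr _ hr
  have b₇ := bounds _ hp _ hpr _ hr
  have b₈ := bounds _ hp _ hpq _ hq
  rw [abs_le]
  constructor <;> linarith [b₁.1, b₁.2, b₂.1, b₂.2, b₃.1, b₃.2, b₄.1, b₄.2, b₅.1, b₅.2,
    b₆.1, b₆.2, b₇.1, b₇.2, b₈.1, b₈.2]

theorem diam_triple_le_iff {p q r : E2} {d : ℝ} :
    Metric.diam ({p, q, r} : Set E2) ≤ d ↔ dist p q ≤ d ∧ dist p r ≤ d ∧ dist q r ≤ d := by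
  rw [Metric.diam_triple]
  simp [and_assoc]

theorem dist_midpoint_midpoint_left_s14 (x y z : E2) :
    dist (midpoint ℝ x y) (midpoint ℝ x z) ≤ dist y z / 2 := by
  have := dist_midpoint_midpoint_le x y x z
  rwa [dist_self, zero_add] at this

theorem corrSum_strat_increment_bound {f g1 g2 : E2 → ℝ} {γ K : ℝ}
    (hbase : ∀ (p q r : E2) (d : ℝ), Metric.diam ({p, q, r} : Set E2) ≤ d →
      |corrSum (strat f g1 g2) 1 p q r - corrSum (strat f g1 g2) 0 p q r| ≤ K * d ^ γ)
    (n : ℕ) (p q r : E2) (d : ℝ) (hd : Metric.diam ({p, q, r} : Set E2) ≤ d) :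
    |corrSum (strat f g1 g2) (n + 1) p q r - corrSum (strat f g1 g2) n p q r| ≤
      K * d ^ γ * ((2 : ℝ) ^ (2 - γ)) ^ n := by
  induction n generalizing p q r d with
  | zero => simpa using hbase p q r d hd
  | succ n ih =>
    have scaling := mul_half_rpow 2 γ (Metric.diam_nonneg.trans hd)
    rw [Real.rpow_two] at scaling
    rw [diam_triple_le_iff] at hd
    obtain ⟨hpq, hpr, hqr⟩ := hd
    have half_pq : dist p (midpoint ℝ p q) = dist p q / 2 := by
      rw [dist_left_midpoint]; norm_num; ring
    have half_qp : dist (midpoint ℝ p q) q = dist p q / 2 := by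
      rw [dist_midpoint_right]; norm_num; ring
    have half_pr : dist p (midpoint ℝ p r) = dist p r / 2 := by
      rw [dist_left_midpoint]; norm_num; ring
    have half_rp : dist (midpoint ℝ p r) r = dist p r / 2 := by
      rw [dist_midpoint_right]; norm_num; ring
    have half_qr : dist q (midpoint ℝ q r) = dist q r / 2 := by
      rw [dist_left_midpoint]; norm_num; ring
    have half_rq : dist (midpoint ℝ q r) r = dist q r / 2 := by
      rw [dist_midpoint_right]; norm_num; ring
    have mid_p := dist_midpoint_midpoint_left_s14 p q r
    have mid_q := dist_midpoint_midpoint_left_s14 q p r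
    have mid_r := dist_midpoint_midpoint_left_s14 r p q
    rw [midpoint_comm (R := ℝ) q p] at mid_q
    rw [midpoint_comm (R := ℝ) r p, midpoint_comm (R := ℝ) r q] at mid_r
    have inner_bound := ih (midpoint ℝ q r) (midpoint ℝ p r) (midpoint ℝ p q) (d / 2)
      (diam_triple_le_iff.2 ⟨by rw [dist_comm]; linarith, by rw [dist_comm]; linarith,
        by rw [dist_comm]; linarith⟩)
    have corner_r := ih (midpoint ℝ p r) (midpoint ℝ q r) r (d / 2)
      (diam_triple_le_iff.2 ⟨by linarith, by linarith, by linarith⟩)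
    have corner_q := ih (midpoint ℝ p q) q (midpoint ℝ q r) (d / 2)
      (diam_triple_le_iff.2 ⟨by linarith, by linarith, by linarith⟩)
    have corner_p := ih p (midpoint ℝ p q) (midpoint ℝ p r) (d / 2)
      (diam_triple_le_iff.2 ⟨by linarith, by linarith, by linarith⟩)
    have total : K * d ^ γ * ((2 : ℝ) ^ (2 - γ)) ^ (n + 1) =
        4 * (K * (d / 2) ^ γ * ((2 : ℝ) ^ (2 - γ)) ^ n) := by
      linear_combination (-K * ((2 : ℝ) ^ (2 - γ)) ^ n) * scaling
    rw [corrSum_strat_succ f g1 g2 (n + 1) p q r, corrSum_strat_succ f g1 g2 n p q r, total]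
    rw [abs_le] at inner_bound corner_r corner_q corner_p ⊢
    constructor <;> linarith [inner_bound.1, inner_bound.2, corner_r.1, corner_r.2,
      corner_q.1, corner_q.2, corner_p.1, corner_p.2]

theorem exists_tendsto_of_geometric_increment {u : ℕ → ℝ} {K ρ : ℝ} (hρ : ρ < 1)
    (hu : ∀ n, |u (n + 1) - u n| ≤ K * ρ ^ n) :
    ∃ l, Tendsto u atTop (nhds l) ∧ ∀ n, |u n - l| ≤ K * ρ ^ n / (1 - ρ) := by
  have hu' : ∀ n, dist (u n) (u (n + 1)) ≤ K * ρ ^ n := fun n => by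
    rw [dist_comm, Real.dist_eq]
    exact hu n
  obtain ⟨l, hl⟩ := cauchySeq_tendsto_of_complete (cauchySeq_of_le_geometric ρ K hρ hu')
  exact ⟨l, hl, fun n => dist_le_of_le_geometric_of_tendsto ρ K hρ hu' hl n⟩

/-- improved convergence rate for corrected dyadic Stratonovich sums. -/
theorem stmt_14 (α β₁ β₂ : ℝ) (hα : α ∈ Set.Ioc (0:ℝ) 1) (hβ₁ : β₁ ∈ Set.Ioc (0:ℝ) 1)
    (hβ₂ : β₂ ∈ Set.Ioc (0:ℝ) 1) (hsum : 2 < α + β₁ + β₂) :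
    ∃ C : ℝ, 0 < C ∧
      ∀ (f g1 g2 : E2 → ℝ) (M Hf H1 H2 : ℝ),
        0 ≤ M → 0 ≤ Hf → 0 ≤ H1 → 0 ≤ H2 →
        (∀ x, |f x| ≤ M) →
        (∀ x y, |f x - f y| ≤ Hf * dist x y ^ α) →
        (∀ x y, |g1 x - g1 y| ≤ H1 * dist x y ^ β₁) →
        (∀ x y, |g2 x - g2 y| ≤ H2 * dist x y ^ β₂) →
        ∃ (S : E2 → E2 → ℝ) (V : E2 → E2 → E2 → ℝ),
          (∀ p q, Tendsto (fun n => sideCorr (strat f g1 g2) n p q) atTop (nhds (S p q))) ∧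
          (∀ p q r, Tendsto (fun n => dyaSum (strat f g1 g2) n p q r) atTop (nhds (V p q r))) ∧
          ∀ (n : ℕ) (p q r : E2),
            |dyaSum (strat f g1 g2) n p q r - V p q r
              - ((sideCorr (strat f g1 g2) n q r - S q r)
                  - (sideCorr (strat f g1 g2) n p r - S p r)
                  + (sideCorr (strat f g1 g2) n p q - S p q))| ≤
              C * (M + Hf) * H1 * H2 * Metric.diam ({p, q, r} : Set E2) ^ (α + β₁ + β₂)
                * (2:ℝ) ^ ((n : ℝ) * (2 - α - β₁ - β₂)) := by
  obtain ⟨hα0, hα1⟩ := hα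
  obtain ⟨hβ₁0, hβ₁1⟩ := hβ₁
  obtain ⟨hβ₂0, hβ₂1⟩ := hβ₂
  have ratio_lt : (2 : ℝ) ^ (2 - (α + β₁ + β₂)) < 1 :=
    Real.rpow_lt_one_of_one_lt_of_neg one_lt_two (by linarith)
  have side_ratio_lt : (2 : ℝ) ^ (1 - (β₁ + β₂)) < 1 :=
    Real.rpow_lt_one_of_one_lt_of_neg one_lt_two (by linarith)
  have gap_pos : 0 < 1 - (2 : ℝ) ^ (2 - (α + β₁ + β₂)) := by linarith
  refine ⟨8 / (1 - (2 : ℝ) ^ (2 - (α + β₁ + β₂))), by positivity, ?_⟩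
  intro f g1 g2 M Hf H1 H2 hM hHf hH1 hH2 hfM hf h1 h2
  have side_germ : ∀ p q, |strat f g1 g2 p (midpoint ℝ p q) q| ≤
      M * H1 * H2 * dist p q ^ (β₁ + β₂) := by
    intro p q
    have hmid : dist (midpoint ℝ p q) p ≤ dist p q := by
      rw [dist_midpoint_left]
      norm_num
      linarith [dist_nonneg (x := p) (y := q)]
    have bound := strat_bound (f := f) (α := 0) (p := p) (q := midpoint ℝ p q) (r := q)
      (d := dist p q) dist_nonneg hβ₁0.le hβ₂0.le hM hH1 hH2 h1 h2
      (by simpa using hfM _) (by simpa using hfM _) (by simpa using hfM _) hmid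
      (dist_comm q p).le
    rwa [Real.rpow_zero, one_mul, ← Real.rpow_add_of_nonneg dist_nonneg hβ₁0.le hβ₂0.le] at bound
  choose S hS _ using fun p q => exists_tendsto_of_geometric_increment
    (u := fun n => sideCorr (strat f g1 g2) n p q) side_ratio_lt fun n =>
      sideCorr_increment_bound side_germ n p q
  have base : ∀ (p q r : E2) (d : ℝ), Metric.diam ({p, q, r} : Set E2) ≤ d →
      |corrSum (strat f g1 g2) 1 p q r - corrSum (strat f g1 g2) 0 p q r| ≤
        8 * (Hf * H1 * H2) * d ^ (α + β₁ + β₂) := by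
    intro p q r d hd
    have d_nonneg : 0 ≤ d := Metric.diam_nonneg.trans hd
    rw [Real.rpow_add_of_nonneg d_nonneg (by linarith) hβ₂0.le,
      Real.rpow_add_of_nonneg d_nonneg hα0.le hβ₁0.le]
    exact corrSum_strat_one_sub_zero_bound hα0.le hβ₁0.le hβ₂0.le hHf hH1 hH2 hf h1 h2 hd
  choose L hL hLbound using fun p q r => exists_tendsto_of_geometric_increment
    (u := fun n => corrSum (strat f g1 g2) n p q r) ratio_lt fun n =>
      corrSum_strat_increment_bound base n p q r _ le_rfl
  refine ⟨S, fun p q r => L p q r + (S q r - S p r + S p q), hS, fun p q r => ?_,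
    fun n p q r => ?_⟩
  · refine ((hL p q r).add (((hS q r).sub (hS p r)).add (hS p q))).congr fun n => ?_
    simp only [corrSum]
    ring
  · have pow_eq : (2 : ℝ) ^ ((n : ℝ) * (2 - α - β₁ - β₂)) =
        ((2 : ℝ) ^ (2 - (α + β₁ + β₂))) ^ n := by
      rw [← Real.rpow_mul_natCast zero_le_two]
      congr 1
      ring
    have diam_nonneg : 0 ≤ Metric.diam ({p, q, r} : Set E2) := Metric.diam_nonneg
    rw [pow_eq]
    calc _ = |corrSum (strat f g1 g2) n p q r - L p q r| := by
          congr 1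
          simp only [corrSum]
          ring
      _ ≤ _ := hLbound p q r n
      _ = 8 / (1 - (2 : ℝ) ^ (2 - (α + β₁ + β₂))) * Hf * H1 * H2
          * Metric.diam ({p, q, r} : Set E2) ^ (α + β₁ + β₂)
          * ((2 : ℝ) ^ (2 - (α + β₁ + β₂))) ^ n := by ring
      _ ≤ _ := by
          gcongr
          linarith
end
end

section
/- Let α, γ, β₁, β₂ ∈ (0,1] satisfy β₁ + β₂ > 1, α + β₁ + β₂ > 2 and (1+γ)·βᵢ + β₁ + β₂ > 2 for i = 1, 2. Let gⁱ : ℝ² → ℝ be βᵢ-Hölder for i = 1, 2, and write g := (g¹, g²) : ℝ² → ℝ². Let F : ℝ² × ℝ² → ℝ be bounded, differentiable in its second variable with gradient ∇_yF, and suppose there is K > 0 such that for all u, v, x, y ∈ ℝ²: |F(u, x) − F(v, x)| ≤ K·|u − v|^α, |∇_yF(u, x) − ∇_yF(u, y)| ≤ K·|x − y|^γ, and |∇_yF(u, x)| ≤ K. Set f(x) := F(x, g(x)). Then for all p, q, r ∈ ℝ² the limit V_{pqr} := lim_{n→∞} strat^n_{pqr} exists; moreover V is alternating, continuous in (p, q,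 r), and V_{pqr} = 0 whenever p, q, r are collinear. -/
open Filter Metric

noncomputable section

/-- The 2-germ obtained by summing a 1-germ over the oriented sides of a triangle. -/
def sideSum (e : E2 → E2 → ℝ) (p q r : E2) : ℝ := e p q + e q r + e r p

/-- Dyadic sums of a 1-germ. -/
def edgeSum (e : E2 → E2 → ℝ) : ℕ → E2 → E2 → ℝ
  | 0 => e
  | n + 1 => fun p q => edgeSum e n p (midpoint ℝ p q) + edgeSum e n (midpoint ℝ p q) q

theorem dyaSum_succ' (ω : E2 → E2 → E2 → ℝ) (n : ℕ) :
    dyaSum ω (n + 1) = dyaSum (dyaSum ω 1) n := by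
  induction n with
  | zero => rfl
  | succ n ih =>
    funext p q r
    rw [dyaSum, ih]
    rfl

theorem dyaSum_add (ω η : E2 → E2 → E2 → ℝ) (n : ℕ) (p q r : E2) :
    dyaSum (fun x y z => ω x y z + η x y z) n p q r = dyaSum ω n p q r + dyaSum η n p q r := by
  induction n generalizing p q r with
  | zero => rfl
  | succ n ih => simp only [dyaSum, ih]; ring

theorem edgeSum_antisymm {e : E2 → E2 → ℝ} (he : ∀ p q, e q p = -e p q) (n : ℕ) (p q : E2) :
    edgeSum e n q p = -edgeSum e n p q := by
  induction n generalizing p q with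
  | zero => exact he p q
  | succ n ih =>
    simp only [edgeSum]
    rw [midpoint_comm q p, ih _ q, ih p]
    ring

/-- In the dyadic sum of `sideSum e` the interior edges cancel. -/
theorem dyaSum_sideSum {e : E2 → E2 → ℝ} (he : ∀ p q, e q p = -e p q) (n : ℕ) (p q r : E2) :
    dyaSum (sideSum e) n p q r = edgeSum e n p q + edgeSum e n q r + edgeSum e n r p := by
  induction n generalizing p q r with
  | zero => rfl
  | succ n ih =>
    simp only [dyaSum, ih, edgeSum]
    have key := edgeSum_antisymm he n
    rw [midpoint_comm r p, key (midpoint ℝ p r) (midpoint ℝ q r),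
      key (midpoint ℝ p q) (midpoint ℝ p r), key (midpoint ℝ p q) (midpoint ℝ q r)]
    ring

theorem abs_dyaSum_le_s15 {A : Set E2} (hA : ∀ x ∈ A, ∀ y ∈ A, midpoint ℝ x y ∈ A)
    {ω : E2 → E2 → E2 → ℝ} {c : ℝ} (n : ℕ) {h : ℝ}
    (hω : ∀ p ∈ A, ∀ q ∈ A, ∀ r ∈ A, dist p q ≤ h / 2 ^ n → dist p r ≤ h / 2 ^ n →
      dist q r ≤ h / 2 ^ n → |ω p q r| ≤ c)
    {p q r : E2} (hp : p ∈ A) (hq : q ∈ A) (hr : r ∈ A)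
    (hpq : dist p q ≤ h) (hpr : dist p r ≤ h) (hqr : dist q r ≤ h) :
    |dyaSum ω n p q r| ≤ 4 ^ n * c := by
  induction n generalizing p q r h with
  | zero =>
    simp only [pow_zero, one_mul, div_one] at *
    exact hω p hp q hq r hr hpq hpr hqr
  | succ n ih =>
    have hω' : ∀ p ∈ A, ∀ q ∈ A, ∀ r ∈ A, dist p q ≤ h / 2 / 2 ^ n → dist p r ≤ h / 2 / 2 ^ n →
        dist q r ≤ h / 2 / 2 ^ n → |ω p q r| ≤ c := by
      have e : h / 2 / 2 ^ n = h / 2 ^ (n + 1) := by rw [div_div, pow_succ']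
      rw [e]
      exact hω
    have a := hA p hp q hq
    have b := hA q hq r hr
    have d := hA p hp r hr
    have dl := dist_midpoint_midpoint_left
    have e1 : dist (midpoint ℝ p q) q = dist p q / 2 := by
      rw [dist_midpoint_right]; norm_num; ring
    have e1' : dist p (midpoint ℝ p q) = dist p q / 2 := by
      rw [dist_left_midpoint]; norm_num; ring
    have e2 : dist (midpoint ℝ q r) r = dist q r / 2 := by
      rw [dist_midpoint_right]; norm_num; ring
    have e2' : dist q (midpoint ℝ q r) = dist q r / 2 := by
      rw [dist_left_midpoint]; norm_num; ring
    have e3 : dist (midpoint ℝ p r) r = dist p r / 2 := by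
      rw [dist_midpoint_right]; norm_num; ring
    have e3' : dist p (midpoint ℝ p r) = dist p r / 2 := by
      rw [dist_left_midpoint]; norm_num; ring
    have f1 : dist (midpoint ℝ p q) (midpoint ℝ p r) = dist q r / 2 := dl _ _ _
    have f2 : dist (midpoint ℝ p q) (midpoint ℝ q r) = dist p r / 2 := by
      rw [midpoint_comm p q]; exact dl _ _ _
    have f3 : dist (midpoint ℝ p r) (midpoint ℝ q r) = dist p q / 2 := by
      rw [midpoint_comm p r, midpoint_comm q r]; exact dl _ _ _
    have t1 := ih hω' b d a (by rw [dist_comm]; linarith) (by rw [dist_comm]; linarith)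
      (by rw [dist_comm]; linarith)
    have t2 := ih hω' d b hr (by linarith) (by linarith) (by linarith)
    have t3 := ih hω' a hq b (by linarith) (by linarith) (by linarith)
    have t4 := ih hω' hp a d (by linarith) (by linarith) (by linarith)
    simp only [dyaSum]
    rw [abs_le] at *
    rw [pow_succ]
    constructor <;> linarith [t1.1, t1.2]

theorem abs_edgeSum_le {A : Set E2} (hA : ∀ x ∈ A, ∀ y ∈ A, midpoint ℝ x y ∈ A)
    {e : E2 → E2 → ℝ} {c : ℝ} (n : ℕ) {h : ℝ}
    (he : ∀ p ∈ A, ∀ q ∈ A, dist p q ≤ h / 2 ^ n → |e p q| ≤ c)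
    {p q : E2} (hp : p ∈ A) (hq : q ∈ A) (hpq : dist p q ≤ h) :
    |edgeSum e n p q| ≤ 2 ^ n * c := by
  induction n generalizing p q h with
  | zero =>
    simp only [pow_zero, one_mul, div_one] at *
    exact he p hp q hq hpq
  | succ n ih =>
    have he' : ∀ p ∈ A, ∀ q ∈ A, dist p q ≤ h / 2 / 2 ^ n → |e p q| ≤ c := by
      have e : h / 2 / 2 ^ n = h / 2 ^ (n + 1) := by rw [div_div, pow_succ']
      rw [e]
      exact he
    have a := hA p hp q hq
    have t1 := ih he' hp a (by rw [dist_left_midpoint]; norm_num; linarith)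
    have t2 := ih he' a hq (by rw [dist_midpoint_right]; norm_num; linarith)
    simp only [edgeSum]
    refine (abs_add_le _ _).trans ?_
    rw [pow_succ]
    linarith

/-- A 2-germ changing sign under transposition of neighbouring arguments. -/
structure IsAlt (ω : E2 → E2 → E2 → ℝ) : Prop where
  swap_left : ∀ p q r, ω q p r = -ω p q r
  swap_right : ∀ p q r, ω p r q = -ω p q r

namespace IsAlt

variable {ω : E2 → E2 → E2 → ℝ}

theorem rotate (hω : IsAlt ω) (p q r : E2) : ω q r p = ω p q r := by
  rw [hω.swap_right, hω.swap_left, neg_neg]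

theorem swap_outer (hω : IsAlt ω) (p q r : E2) : ω r q p = -ω p q r := by
  rw [hω.swap_left, hω.rotate]

theorem eq_zero (hω : IsAlt ω) {p q r : E2} (h : p = q ∨ p = r ∨ q = r) : ω p q r = 0 := by
  rcases h with rfl | rfl | rfl
  · linarith [hω.swap_left p p r]
  · linarith [hω.swap_outer p q p]
  · linarith [hω.swap_right p q q]

theorem alternating2 (hω : IsAlt ω) : Alternating2 ω := by
  have perm_cases : ∀ σ : Equiv.Perm (Fin 3), (σ 0, σ 1, σ 2, Equiv.Perm.sign σ) ∈
      [((0 : Fin 3), (1 : Fin 3), (2 : Fin 3), (1 : ℤˣ)), (1, 2, 0, 1), (2, 0, 1, 1),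
        (1, 0, 2, -1), (0, 2, 1, -1), (2, 1, 0, -1)] := by decide
  intro σ p
  have h := perm_cases σ
  simp only [List.mem_cons, Prod.mk.injEq, List.not_mem_nil, or_false] at h
  have r1 := hω.rotate (p 0) (p 1) (p 2)
  have r2 := hω.rotate (p 1) (p 2) (p 0)
  have s1 := hω.swap_left (p 0) (p 1) (p 2)
  have s2 := hω.swap_right (p 0) (p 1) (p 2)
  have s3 := hω.swap_outer (p 0) (p 1) (p 2)
  rcases h with ⟨h0, h1, h2, h3⟩ | ⟨h0, h1, h2, h3⟩ | ⟨h0, h1, h2, h3⟩ | ⟨h0, h1, h2, h3⟩ |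
    ⟨h0, h1, h2, h3⟩ | ⟨h0, h1, h2, h3⟩ <;> rw [h0, h1, h2, h3] <;> push_cast <;> linarith

theorem dyaSum (hω : IsAlt ω) (n : ℕ) : IsAlt (dyaSum ω n) := by
  induction n with
  | zero => exact hω
  | succ n ih =>
    constructor
    · intro p q r
      simp only [_root_.dyaSum]
      rw [midpoint_comm q p, ih.swap_left (midpoint ℝ q r) (midpoint ℝ p r) (midpoint ℝ p q),
        ih.swap_left (midpoint ℝ p r) (midpoint ℝ q r) r, ih.swap_left p (midpoint ℝ p q),
        ih.swap_left (midpoint ℝ p q) q]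
      ring
    · intro p q r
      simp only [_root_.dyaSum]
      rw [midpoint_comm r q, ih.swap_right (midpoint ℝ q r) (midpoint ℝ p r) (midpoint ℝ p q),
        ih.swap_right (midpoint ℝ p r) (midpoint ℝ q r) r, ih.swap_right p (midpoint ℝ p q),
        ih.swap_right (midpoint ℝ p q) q]
      ring

/-- One subdivision step produces side terms and four coboundaries. -/
theorem dyaSum_one_eq (hω : IsAlt ω) (p q r : E2) :
    _root_.dyaSum ω 1 p q r = ω p q r + sideSum (fun x y => ω x (midpoint ℝ x y) y) p q r
      + (cob ω p (midpoint ℝ p q) q r - cob ω (midpoint ℝ p q) q (midpoint ℝ q r) r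
        + cob ω p (midpoint ℝ p q) r (midpoint ℝ p r)
        + cob ω (midpoint ℝ p q) (midpoint ℝ q r) r (midpoint ℝ p r)) := by
  simp only [_root_.dyaSum, cob, sideSum]
  rw [midpoint_comm r p, hω.rotate (midpoint ℝ p q) (midpoint ℝ q r) (midpoint ℝ p r),
    ← hω.rotate (midpoint ℝ p r) (midpoint ℝ q r) r, hω.rotate p r (midpoint ℝ p r)]
  ring

end IsAlt

/-- The 1-germ comparing a 2-germ with its pullback by `π`, antisymmetrised. -/
def prismSide (ω : E2 → E2 → E2 → ℝ) (π : E2 → E2) (a b : E2) : ℝ :=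
  ((ω a b (π b) - ω a (π a) (π b)) - (ω b a (π a) - ω b (π b) (π a))) / 2

theorem prismSide_antisymm (ω : E2 → E2 → E2 → ℝ) (π : E2 → E2) (a b : E2) :
    prismSide ω π b a = -prismSide ω π a b := by
  unfold prismSide; ring

theorem IsAlt.sub_prismSide {ω : E2 → E2 → E2 → ℝ} (hω : IsAlt ω) (π : E2 → E2) (a b c : E2) :
    ω a b c - sideSum (prismSide ω π) a b c = ω (π a) (π b) (π c)
      - (cob ω a b c (π c) - cob ω a b (π b) (π c) + cob ω a (π a) (π b) (π c))
      + (cob ω a b (π a) (π b) + cob ω b c (π b) (π c) - cob ω a c (π a) (π c)) / 2 := by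
  have s := hω.swap_left
  have t := hω.swap_right
  simp only [sideSum, prismSide, cob]
  rw [s a b (π a), s b c (π b), s a c (π a), t b (π a) (π b), t c (π b) (π c), t c (π a) (π c)]
  ring

/-- A 2-germ is of order `β` if it is `O(h ^ β)` on triples contained in a ball of radius `h`. -/
def HasOrder (ω : E2 → E2 → E2 → ℝ) (β : ℝ) : Prop :=
  ∃ D, 0 ≤ D ∧ ∀ h, 0 ≤ h → ∀ c p q r : E2, p ∈ closedBall c h → q ∈ closedBall c h →
    r ∈ closedBall c h → |ω p q r| ≤ D * h ^ β

/-- The coboundary of `ω` is of order `θ`, uniformly for bounded radii. -/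
def HasCobOrder (ω : E2 → E2 → E2 → ℝ) (θ : ℝ) : Prop :=
  ∀ H, ∃ C, 0 ≤ C ∧ ∀ h, 0 ≤ h → h ≤ H → ∀ c p q r s : E2, p ∈ closedBall c h →
    q ∈ closedBall c h → r ∈ closedBall c h → s ∈ closedBall c h → |cob ω p q r s| ≤ C * h ^ θ

theorem midpoint_mem_closedBall {c p q : E2} {h : ℝ} (hp : p ∈ closedBall c h)
    (hq : q ∈ closedBall c h) : midpoint ℝ p q ∈ closedBall c h :=
  (convex_closedBall c h).midpoint_mem hp hq

theorem summable_pow_mul_rpow {a H θ : ℝ} (ha : 0 ≤ a) (hH : 0 ≤ H) (h : a < 2 ^ θ) :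
    Summable fun n : ℕ => a ^ n * (H / 2 ^ n) ^ θ := by
  have h2 : (0 : ℝ) < 2 ^ θ := by positivity
  have e : (fun n : ℕ => a ^ n * (H / 2 ^ n) ^ θ) = fun n : ℕ => H ^ θ * (a / 2 ^ θ) ^ n := by
    funext n
    rw [Real.div_rpow hH (by positivity), div_pow, Real.rpow_pow_comm (by norm_num)]
    ring
  rw [e]
  exact (summable_geometric_of_lt_one (by positivity) ((div_lt_one h2).2 h)).mul_left _

theorem two_lt_two_rpow {β : ℝ} (h : 1 < β) : (2 : ℝ) < 2 ^ β := by
  simpa using Real.rpow_lt_rpow_of_exponent_lt (x := 2) (by norm_num) h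

theorem four_lt_two_rpow {θ : ℝ} (h : 2 < θ) : (4 : ℝ) < 2 ^ θ := by
  have := Real.rpow_lt_rpow_of_exponent_lt (x := 2) (by norm_num) h
  norm_num at this
  exact this

section Sewing

variable {ω : E2 → E2 → E2 → ℝ} {β θ : ℝ}

/-- The increments of the dyadic sums are dominated by a summable sequence, locally uniformly. -/
theorem exists_summable_bound (hω : IsAlt ω) (hβ : 1 < β) (hθ : 2 < θ) (ho : HasOrder ω β)
    (hc : HasCobOrder ω θ) {H : ℝ} (hH : 0 ≤ H) :
    ∃ u : ℕ → ℝ, Summable u ∧ ∀ n p q r, dist p q ≤ H → dist p r ≤ H → dist q r ≤ H →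
      |dyaSum ω (n + 1) p q r - dyaSum ω n p q r| ≤ u n := by
  obtain ⟨D, hD, ho⟩ := ho
  obtain ⟨C, hC, hc⟩ := hc H
  refine ⟨fun n => 4 * C * (4 ^ n * (H / 2 ^ n) ^ θ) + 3 * D * (2 ^ n * (H / 2 ^ n) ^ β),
    ((summable_pow_mul_rpow (by norm_num) hH (four_lt_two_rpow hθ)).mul_left _).add
      ((summable_pow_mul_rpow (by norm_num) hH (two_lt_two_rpow hβ)).mul_left _), ?_⟩
  intro n p q r hpq hpr hqr
  set side : E2 → E2 → ℝ := fun x y => ω x (midpoint ℝ x y) y with hside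
  have hanti : ∀ x y, side y x = -side x y := fun x y => by
    simp only [hside]
    rw [midpoint_comm y x, hω.swap_outer]
  set R : E2 → E2 → E2 → ℝ := fun x y z => dyaSum ω 1 x y z - ω x y z - sideSum side x y z
    with hR
  have hsplit : dyaSum ω (n + 1) p q r - dyaSum ω n p q r =
      dyaSum R n p q r + (edgeSum side n p q + edgeSum side n q r + edgeSum side n r p) := by
    have e : dyaSum ω 1 = fun x y z => (fun x y z => ω x y z + sideSum side x y z) x y z
        + R x y z := by
      funext x y z
      simp only [hR]
      ring
    rw [dyaSum_succ', e, dyaSum_add, dyaSum_add, dyaSum_sideSum hanti]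
    ring
  have hh : 0 ≤ H / 2 ^ n := by positivity
  have hhH : H / 2 ^ n ≤ H := div_le_self hH (one_le_pow₀ (by norm_num))
  have univ_mid : ∀ x ∈ (Set.univ : Set E2), ∀ y ∈ (Set.univ : Set E2),
      midpoint ℝ x y ∈ (Set.univ : Set E2) := fun _ _ _ _ => trivial
  have hRb : |dyaSum R n p q r| ≤ 4 ^ n * (4 * (C * (H / 2 ^ n) ^ θ)) := by
    refine abs_dyaSum_le_s15 univ_mid n ?_ trivial trivial trivial hpq hpr hqr
    intro x _ y _ z _ hxy hxz _
    have mx : x ∈ closedBall x (H / 2 ^ n) := mem_closedBall_self hh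
    have my : y ∈ closedBall x (H / 2 ^ n) := by rwa [mem_closedBall']
    have mz : z ∈ closedBall x (H / 2 ^ n) := by rwa [mem_closedBall']
    have mxy := midpoint_mem_closedBall mx my
    have mxz := midpoint_mem_closedBall mx mz
    have myz := midpoint_mem_closedBall my mz
    have c1 := abs_le.1 (hc _ hh hhH x _ _ _ _ mx mxy my mz)
    have c2 := abs_le.1 (hc _ hh hhH x _ _ _ _ mxy my myz mz)
    have c3 := abs_le.1 (hc _ hh hhH x _ _ _ _ mx mxy mz mxz)
    have c4 := abs_le.1 (hc _ hh hhH x _ _ _ _ mxy myz mz mxz)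
    simp only [hR]
    rw [hω.dyaSum_one_eq, abs_le]
    constructor <;> linarith [c1.1, c1.2, c2.1, c2.2]
  have hS : ∀ x y, dist x y ≤ H → |edgeSum side n x y| ≤ 2 ^ n * (D * (H / 2 ^ n) ^ β) := by
    intro x y hxy
    refine abs_edgeSum_le univ_mid n ?_ trivial trivial hxy
    intro x _ y _ hxy
    have mx : x ∈ closedBall x (H / 2 ^ n) := mem_closedBall_self hh
    have my : y ∈ closedBall x (H / 2 ^ n) := by rwa [mem_closedBall']
    exact ho _ hh x _ _ _ mx (midpoint_mem_closedBall mx my) my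
  have s1 := abs_le.1 (hS p q hpq)
  have s2 := abs_le.1 (hS q r hqr)
  have s3 := abs_le.1 (hS r p (by rwa [dist_comm]))
  have s0 := abs_le.1 hRb
  rw [hsplit, abs_le]
  constructor <;> linarith [s0.1, s0.2, s1.1, s1.2]

theorem continuous_dyaSum (hcont : Continuous fun x : E2 × E2 × E2 => ω x.1 x.2.1 x.2.2) (n : ℕ) :
    Continuous fun x : E2 × E2 × E2 => dyaSum ω n x.1 x.2.1 x.2.2 := by
  induction n with
  | zero => exact hcont
  | succ n ih =>
    have mid : ∀ {a b : E2 × E2 × E2 → E2}, Continuous a → Continuous b →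
        Continuous fun x => midpoint ℝ (a x) (b x) := fun ha hb => by
      simp only [midpoint_eq_smul_add]
      fun_prop
    have comp : ∀ {a b c : E2 × E2 × E2 → E2}, Continuous a → Continuous b → Continuous c →
        Continuous fun x => dyaSum ω n (a x) (b x) (c x) := fun ha hb hc =>
      ih.comp (ha.prodMk (hb.prodMk hc))
    have h0 : Continuous fun x : E2 × E2 × E2 => x.1 := by fun_prop
    have h1 : Continuous fun x : E2 × E2 × E2 => x.2.1 := by fun_prop
    have h2 : Continuous fun x : E2 × E2 × E2 => x.2.2 := by fun_prop
    exact (((comp (mid h1 h2) (mid h0 h2) (mid h0 h1)).add (comp (mid h0 h2) (mid h1 h2) h2)).add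
      (comp (mid h0 h1) h1 (mid h1 h2))).add (comp h0 (mid h0 h1) (mid h0 h2))

/-- Convergence of the dyadic sums to a continuous limit. -/
theorem exists_tendsto_dyaSum (hω : IsAlt ω) (hβ : 1 < β) (hθ : 2 < θ) (ho : HasOrder ω β)
    (hc : HasCobOrder ω θ) (hcont : Continuous fun x : E2 × E2 × E2 => ω x.1 x.2.1 x.2.2) :
    ∃ V : E2 → E2 → E2 → ℝ,
      (∀ p q r, Tendsto (fun n => dyaSum ω n p q r) atTop (nhds (V p q r))) ∧
      Continuous fun x : E2 × E2 × E2 => V x.1 x.2.1 x.2.2 := by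
  refine ⟨fun p q r => ω p q r + ∑' n, (dyaSum ω (n + 1) p q r - dyaSum ω n p q r), ?_, ?_⟩
  · intro p q r
    have hH : 0 ≤ dist p q + dist p r + dist q r := by positivity
    obtain ⟨u, hu, hb⟩ := exists_summable_bound hω hβ hθ ho hc hH
    have hs : Summable fun n => dyaSum ω (n + 1) p q r - dyaSum ω n p q r := by
      refine Summable.of_norm_bounded hu fun n => hb n p q r ?_ ?_ ?_ <;>
      linarith [dist_nonneg (x := p) (y := q), dist_nonneg (x := p) (y := r),
        dist_nonneg (x := q) (y := r)]
    have ht := (hs.hasSum.tendsto_sum_nat).const_add (ω p q r)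
    refine ht.congr fun n => ?_
    rw [Finset.sum_range_sub (fun n => dyaSum ω n p q r)]
    simp [dyaSum]
  · refine hcont.add (continuous_iff_continuousAt.2 fun x => ?_)
    set s : ℝ → Set (E2 × E2 × E2) := fun H =>
      {y | dist y.1 y.2.1 < H ∧ dist y.1 y.2.2 < H ∧ dist y.2.1 y.2.2 < H}
    set H := dist x.1 x.2.1 + dist x.1 x.2.2 + dist x.2.1 x.2.2 + 1 with hHdef
    have hH : 0 ≤ H := by positivity
    obtain ⟨u, hu, hb⟩ := exists_summable_bound hω hβ hθ ho hc hH
    have hopen : IsOpen (s H) :=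
      (isOpen_lt (continuous_fst.dist continuous_snd.fst) continuous_const).inter
        ((isOpen_lt (continuous_fst.dist continuous_snd.snd) continuous_const).inter
          (isOpen_lt (continuous_snd.fst.dist continuous_snd.snd) continuous_const))
    have hx : x ∈ s H := by
      refine ⟨?_, ?_, ?_⟩ <;>
      linarith [dist_nonneg (x := x.1) (y := x.2.1), dist_nonneg (x := x.1) (y := x.2.2),
        dist_nonneg (x := x.2.1) (y := x.2.2)]
    refine (continuousOn_tsum (s := s H) (fun n => ?_) hu ?_).continuousAt (hopen.mem_nhds hx)
    · exact ((continuous_dyaSum hcont (n + 1)).sub (continuous_dyaSum hcont n)).continuousOn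
    · intro n y hy
      exact hb n _ _ _ hy.1.le hy.2.1.le hy.2.2.le

/-- If arbitrarily fine roundings on `A` collapse all small triangles, then the dyadic sums
over triangles with vertices in `A` vanish in the limit. -/
theorem tendsto_dyaSum_zero (hω : IsAlt ω) (hβ : 1 < β) (hθ : 2 < θ) (ho : HasOrder ω β)
    (hc : HasCobOrder ω θ) {A : Set E2} (hA : ∀ x ∈ A, ∀ y ∈ A, midpoint ℝ x y ∈ A)
    (hround : ∀ h : ℝ, 0 < h → ∃ π : E2 → E2, (∀ x ∈ A, dist x (π x) ≤ h) ∧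
      ∀ x ∈ A, ∀ y ∈ A, ∀ z ∈ A, dist x y ≤ h → dist x z ≤ h → dist y z ≤ h →
        π x = π y ∨ π x = π z ∨ π y = π z)
    {p q r : E2} (hp : p ∈ A) (hq : q ∈ A) (hr : r ∈ A) :
    Tendsto (fun n => dyaSum ω n p q r) atTop (nhds 0) := by
  set H := dist p q + dist p r + dist q r + 1 with hHdef
  have d1 := dist_nonneg (x := p) (y := q)
  have d2 := dist_nonneg (x := p) (y := r)
  have d3 := dist_nonneg (x := q) (y := r)
  have hH : 0 < H := by positivity
  obtain ⟨D, hD, ho⟩ := ho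
  obtain ⟨C, hC, hc⟩ := hc (2 * H)
  have l4 := (summable_pow_mul_rpow (a := 4) (H := 2 * H) (by norm_num) (by positivity)
    (four_lt_two_rpow hθ)).tendsto_atTop_zero
  have l2 := (summable_pow_mul_rpow (a := 2) (H := 2 * H) (by norm_num) (by positivity)
    (two_lt_two_rpow hβ)).tendsto_atTop_zero
  have lim := (l4.const_mul (5 * C)).add (l2.const_mul (6 * D))
  simp only [mul_zero, add_zero] at lim
  refine squeeze_zero_norm (fun n => ?_) lim
  have hh : 0 < H / 2 ^ n := by positivity
  have hh2 : 0 ≤ 2 * H / 2 ^ n := by positivity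
  have e2 : 2 * H / 2 ^ n = H / 2 ^ n + H / 2 ^ n := by ring
  have hhH : 2 * H / 2 ^ n ≤ 2 * H := div_le_self (by positivity) (one_le_pow₀ (by norm_num))
  obtain ⟨π, hπ, hcol⟩ := hround _ hh
  have mem : ∀ x y : E2, dist x y ≤ H / 2 ^ n → y ∈ closedBall x (2 * H / 2 ^ n) := fun x y hxy => by
    rw [mem_closedBall']
    linarith
  have memπ : ∀ x : E2, ∀ y ∈ A, dist x y ≤ H / 2 ^ n → π y ∈ closedBall x (2 * H / 2 ^ n) :=
    fun x y hy hxy => by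
      rw [mem_closedBall']
      linarith [dist_triangle x y (π y), hπ y hy]
  set e := prismSide ω π with he
  set R : E2 → E2 → E2 → ℝ := fun x y z => ω x y z - sideSum e x y z with hR
  have hsplit : dyaSum ω n p q r =
      dyaSum R n p q r + (edgeSum e n p q + edgeSum e n q r + edgeSum e n r p) := by
    have e' : ω = fun x y z => R x y z + sideSum e x y z := by
      funext x y z
      simp only [hR]
      ring
    conv_lhs => rw [e']
    rw [dyaSum_add, dyaSum_sideSum (prismSide_antisymm ω π)]
  have hRb : |dyaSum R n p q r| ≤ 4 ^ n * (5 * (C * (2 * H / 2 ^ n) ^ θ)) := by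
    refine abs_dyaSum_le_s15 hA n ?_ hp hq hr (h := H) (by linarith) (by linarith) (by linarith)
    intro x hx y hy z hz hxy hxz hyz
    have mx := mem x x (by rw [dist_self]; exact hh.le)
    have my := mem x y hxy
    have mz := mem x z hxz
    have nx := memπ x x hx (by rw [dist_self]; exact hh.le)
    have ny := memπ x y hy hxy
    have nz := memπ x z hz hxz
    have c1 := abs_le.1 (hc _ hh2 hhH x _ _ _ _ mx my mz nz)
    have c2 := abs_le.1 (hc _ hh2 hhH x _ _ _ _ mx my ny nz)
    have c3 := abs_le.1 (hc _ hh2 hhH x _ _ _ _ mx nx ny nz)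
    have c4 := abs_le.1 (hc _ hh2 hhH x _ _ _ _ mx my nx ny)
    have c5 := abs_le.1 (hc _ hh2 hhH x _ _ _ _ my mz ny nz)
    have c6 := abs_le.1 (hc _ hh2 hhH x _ _ _ _ mx mz nx nz)
    simp only [hR, he]
    rw [hω.sub_prismSide, hω.eq_zero (hcol x hx y hy z hz hxy hxz hyz), abs_le]
    constructor <;> linarith [c1.1, c1.2, c2.1, c2.2]
  have hS : ∀ x ∈ A, ∀ y ∈ A, dist x y ≤ H →
      |edgeSum e n x y| ≤ 2 ^ n * (2 * (D * (2 * H / 2 ^ n) ^ β)) := by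
    intro x hx y hy hxy
    refine abs_edgeSum_le hA n ?_ hx hy hxy
    intro x hx y hy hxy
    have mx := mem x x (by rw [dist_self]; exact hh.le)
    have my := mem x y hxy
    have nx := memπ x x hx (by rw [dist_self]; exact hh.le)
    have ny := memπ x y hy hxy
    have c1 := abs_le.1 (ho _ hh2 x _ _ _ mx my ny)
    have c2 := abs_le.1 (ho _ hh2 x _ _ _ mx nx ny)
    have c3 := abs_le.1 (ho _ hh2 x _ _ _ my mx nx)
    have c4 := abs_le.1 (ho _ hh2 x _ _ _ my ny nx)
    simp only [he, prismSide]
    rw [abs_le]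
    constructor <;> linarith [c1.1, c1.2, c2.1, c2.2]
  have s1 := abs_le.1 (hS p hp q hq (by linarith))
  have s2 := abs_le.1 (hS q hq r hr (by linarith))
  have s3 := abs_le.1 (hS r hr p hp (by rw [dist_comm]; linarith))
  have s0 := abs_le.1 hRb
  rw [hsplit, Real.norm_eq_abs, abs_le]
  constructor <;> linarith [s0.1, s0.2, s1.1, s1.2]

end Sewing

theorem exists_line_of_collinear {p q r : E2}
    (h : (q 0 - p 0) * (r 1 - p 1) - (q 1 - p 1) * (r 0 - p 0) = 0) :
    ∃ v : E2, ‖v‖ = 1 ∧ ∃ a b : ℝ, q = p + a • v ∧ r = p + b • v := by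
  have key : ∀ q r : E2, q ≠ p → (q 0 - p 0) * (r 1 - p 1) - (q 1 - p 1) * (r 0 - p 0) = 0 →
      ∃ v : E2, ‖v‖ = 1 ∧ ∃ a b : ℝ, q = p + a • v ∧ r = p + b • v := by
    intro q r hq h
    have hw : q - p ≠ 0 := sub_ne_zero.2 hq
    have hn : ‖q - p‖ ≠ 0 := norm_ne_zero_iff.2 hw
    have hs : (q 0 - p 0) ^ 2 + (q 1 - p 1) ^ 2 ≠ 0 := by
      intro h0
      apply hw
      ext i
      fin_cases i
      · simp; nlinarith [sq_nonneg (q 0 - p 0), sq_nonneg (q 1 - p 1)]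
      · simp; nlinarith [sq_nonneg (q 0 - p 0), sq_nonneg (q 1 - p 1)]
    set c := ((r 0 - p 0) * (q 0 - p 0) + (r 1 - p 1) * (q 1 - p 1)) /
      ((q 0 - p 0) ^ 2 + (q 1 - p 1) ^ 2) with hc
    refine ⟨‖q - p‖⁻¹ • (q - p), by
      rw [norm_smul, norm_inv, norm_norm, inv_mul_cancel₀ hn], ‖q - p‖, c * ‖q - p‖, ?_, ?_⟩
    · rw [smul_smul, mul_inv_cancel₀ hn, one_smul, add_sub_cancel]
    · rw [smul_smul, mul_assoc, mul_inv_cancel₀ hn, mul_one]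
      ext i
      fin_cases i
      · simp [hc]
        field_simp
        linear_combination (-(q 1 - p 1)) * h
      · simp [hc]
        field_simp
        linear_combination ((q 0 - p 0)) * h
  by_cases hq : q = p
  · by_cases hr : r = p
    · refine ⟨EuclideanSpace.single 0 1, by simp, 0, 0, by simp [hq], by simp [hr]⟩
    · obtain ⟨v, hv, a, b, h1, h2⟩ := key r q hr (by linarith)
      exact ⟨v, hv, b, a, h2, h1⟩
  · exact key q r hq h

/-- Among three reals at mutual distance at most one, two have the same integer part. -/
theorem floor_eq_or_of_abs_sub_le_one {x y z : ℝ} (hxy : |x - y| ≤ 1) (hxz : |x - z| ≤ 1)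
    (hyz : |y - z| ≤ 1) : ⌊x⌋ = ⌊y⌋ ∨ ⌊x⌋ = ⌊z⌋ ∨ ⌊y⌋ = ⌊z⌋ := by
  have key : ∀ {s t : ℝ}, |s - t| ≤ 1 → ⌊s⌋ < ⌊t⌋ + 2 ∧ ⌊t⌋ < ⌊s⌋ + 2 := fun {s t} h => by
    have h := abs_le.1 h
    constructor
    · have : (⌊s⌋ : ℝ) < ⌊t⌋ + 2 := by linarith [Int.floor_le s, Int.lt_floor_add_one t]
      exact_mod_cast this
    · have : (⌊t⌋ : ℝ) < ⌊s⌋ + 2 := by linarith [Int.floor_le t, Int.lt_floor_add_one s]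
      exact_mod_cast this
  have := key hxy
  have := key hxz
  have := key hyz
  omega

theorem exists_rounding_line (p v : E2) (hv : ‖v‖ = 1) {h : ℝ} (hh : 0 < h) :
    ∃ π : E2 → E2, (∀ x ∈ Set.range fun t : ℝ => p + t • v, dist x (π x) ≤ h) ∧
      ∀ x ∈ Set.range fun t : ℝ => p + t • v, ∀ y ∈ Set.range fun t : ℝ => p + t • v,
      ∀ z ∈ Set.range fun t : ℝ => p + t • v, dist x y ≤ h → dist x z ≤ h → dist y z ≤ h →
        π x = π y ∨ π x = π z ∨ π y = π z := by
  have hdist : ∀ s t : ℝ, dist (p + s • v) (p + t • v) = |s - t| := fun s t => by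
    rw [dist_add_left, dist_eq_norm, ← sub_smul, norm_smul, hv, mul_one, Real.norm_eq_abs]
  have hcoord : ∀ t : ℝ, inner ℝ v (p + t • v - p) = t := fun t => by
    rw [add_sub_cancel_left, inner_smul_right, real_inner_self_eq_norm_sq, hv]
    ring
  refine ⟨fun x => p + (h * ⌊inner ℝ v (x - p) / h⌋) • v, ?_, ?_⟩
  · rintro _ ⟨t, rfl⟩
    simp only [hcoord, hdist]
    have h1 := Int.floor_le (t / h)
    have h2 := Int.lt_floor_add_one (t / h)
    rw [le_div_iff₀ hh] at h1
    rw [div_lt_iff₀ hh] at h2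
    rw [abs_le]
    constructor <;> nlinarith
  · rintro _ ⟨s, rfl⟩ _ ⟨t, rfl⟩ _ ⟨u, rfl⟩
    simp only [hcoord, hdist]
    intro h1 h2 h3
    have scale : ∀ {a b : ℝ}, |a - b| ≤ h → |a / h - b / h| ≤ 1 := fun {a b} hab => by
      rwa [← sub_div, abs_div, abs_of_pos hh, div_le_one hh]
    rcases floor_eq_or_of_abs_sub_le_one (scale h1) (scale h2) (scale h3) with e | e | e <;>
    simp [e]

theorem isAlt_strat (f g1 g2 : E2 → ℝ) : IsAlt (strat f g1 g2) := by
  constructor <;> intro p q r <;> unfold strat <;> ring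

theorem abs_strat_le {f g1 g2 : E2 → ℝ} {p q r : E2} {ε G₁ G₂ : ℝ}
    (hp : |f p| ≤ ε) (hq : |f q| ≤ ε) (hr : |f r| ≤ ε)
    (h1q : |g1 q - g1 p| ≤ G₁) (h1r : |g1 r - g1 p| ≤ G₁)
    (h2q : |g2 q - g2 p| ≤ G₂) (h2r : |g2 r - g2 p| ≤ G₂) :
    |strat f g1 g2 p q r| ≤ ε * (G₁ * G₂) := by
  have hG : 0 ≤ G₁ := (abs_nonneg _).trans h1q
  have a : |(f p + f q + f r) / 3| ≤ ε := by
    rw [abs_le] at *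
    constructor <;> linarith [hp.1, hp.2, hq.1, hq.2]
  have b1 : |(g1 q - g1 p) * (g2 r - g2 p)| ≤ G₁ * G₂ := by
    rw [abs_mul]
    exact mul_le_mul h1q h2r (abs_nonneg _) hG
  have b2 : |(g1 r - g1 p) * (g2 q - g2 p)| ≤ G₁ * G₂ := by
    rw [abs_mul]
    exact mul_le_mul h1r h2q (abs_nonneg _) hG
  have b : |(1 / 2 : ℝ) * ((g1 q - g1 p) * (g2 r - g2 p) - (g1 r - g1 p) * (g2 q - g2 p))|
      ≤ G₁ * G₂ := by
    rw [abs_le] at *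
    constructor <;> linarith [b1.1, b1.2, b2.1, b2.2]
  have e : strat f g1 g2 p q r = (f p + f q + f r) / 3 *
      ((1 / 2 : ℝ) * ((g1 q - g1 p) * (g2 r - g2 p) - (g1 r - g1 p) * (g2 q - g2 p))) := by
    unfold strat
    ring
  rw [e, abs_mul]
  exact mul_le_mul a b (abs_nonneg _) ((abs_nonneg _).trans a)

/-- Affine functions of `(g1, g2)` do not contribute to the coboundary of the Stratonovich germ. -/
theorem cob_strat_sub_affine (f g1 g2 : E2 → ℝ) (a₀ a₁ a₂ b₁ b₂ : ℝ) (p q r s : E2) :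
    cob (strat f g1 g2) p q r s =
      cob (strat (fun x => f x - a₀ - a₁ * (g1 x - b₁) - a₂ * (g2 x - b₂)) g1 g2) p q r s := by
  simp only [cob, strat]
  ring

theorem abs_sub_le_of_mem_closedBall {g : E2 → ℝ} {H β : ℝ} (hβ : 0 ≤ β) (hH : 0 ≤ H)
    (hg : ∀ x y, |g x - g y| ≤ H * dist x y ^ β) {c p q : E2} {h : ℝ}
    (hp : p ∈ closedBall c h) (hq : q ∈ closedBall c h) :
    |g p - g q| ≤ H * 2 ^ β * h ^ β := by
  have hh : 0 ≤ h := dist_nonneg.trans hp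
  refine (hg p q).trans ?_
  rw [mul_assoc, ← Real.mul_rpow (by norm_num) hh]
  rw [mem_closedBall] at hp
  rw [mem_closedBall'] at hq
  gcongr
  linarith [dist_triangle p c q]

theorem hasOrder_strat {f g1 g2 : E2 → ℝ} {M H₁ H₂ β₁ β₂ : ℝ} (hβ₁ : 0 ≤ β₁) (hβ₂ : 0 ≤ β₂)
    (hH₁ : 0 ≤ H₁) (hH₂ : 0 ≤ H₂) (hf : ∀ x, |f x| ≤ M)
    (hg1 : ∀ x y, |g1 x - g1 y| ≤ H₁ * dist x y ^ β₁)
    (hg2 : ∀ x y, |g2 x - g2 y| ≤ H₂ * dist x y ^ β₂) :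
    HasOrder (strat f g1 g2) (β₁ + β₂) := by
  have hM : 0 ≤ M := (abs_nonneg _).trans (hf 0)
  refine ⟨M * (H₁ * 2 ^ β₁ * (H₂ * 2 ^ β₂)), by positivity, ?_⟩
  intro h hh c p q r hp hq hr
  have k1 {x y : E2} := abs_sub_le_of_mem_closedBall hβ₁ hH₁ hg1 (c := c) (p := x) (q := y) (h := h)
  have k2 {x y : E2} := abs_sub_le_of_mem_closedBall hβ₂ hH₂ hg2 (c := c) (p := x) (q := y) (h := h)
  refine (abs_strat_le (hf p) (hf q) (hf r) (k1 hq hp) (k1 hr hp) (k2 hq hp)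
    (k2 hr hp)).trans_eq ?_
  rw [Real.rpow_add_of_nonneg hh hβ₁ hβ₂]
  ring

/-- If `f` is controlled by `(g1, g2)` up to order `τ`, then the coboundary of the Stratonovich
germ is of order `τ + β₁ + β₂`. -/
theorem hasCobOrder_strat {f g1 g2 : E2 → ℝ} {H₁ H₂ β₁ β₂ τ : ℝ} (hβ₁ : 0 ≤ β₁) (hβ₂ : 0 ≤ β₂)
    (hτ : 0 ≤ τ) (hH₁ : 0 ≤ H₁) (hH₂ : 0 ≤ H₂)
    (hg1 : ∀ x y, |g1 x - g1 y| ≤ H₁ * dist x y ^ β₁)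
    (hg2 : ∀ x y, |g2 x - g2 y| ≤ H₂ * dist x y ^ β₂)
    (hf : ∀ H, ∃ C, 0 ≤ C ∧ ∀ c, ∃ a₁ a₂ : ℝ, ∀ x, dist x c ≤ H →
      |f x - f c - a₁ * (g1 x - g1 c) - a₂ * (g2 x - g2 c)| ≤ C * dist x c ^ τ) :
    HasCobOrder (strat f g1 g2) (τ + (β₁ + β₂)) := by
  intro H
  obtain ⟨C, hC, hf⟩ := hf H
  refine ⟨4 * (C * (H₁ * 2 ^ β₁ * (H₂ * 2 ^ β₂))), by positivity, ?_⟩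
  intro h hh hhH c p q r s hp hq hr hs
  obtain ⟨a₁, a₂, hf⟩ := hf c
  have k1 {x y : E2} := abs_sub_le_of_mem_closedBall hβ₁ hH₁ hg1 (c := c) (p := x) (q := y) (h := h)
  have k2 {x y : E2} := abs_sub_le_of_mem_closedBall hβ₂ hH₂ hg2 (c := c) (p := x) (q := y) (h := h)
  rw [cob_strat_sub_affine f g1 g2 (f c) a₁ a₂ (g1 c) (g2 c)]
  set ρ : E2 → ℝ := fun x => f x - f c - a₁ * (g1 x - g1 c) - a₂ * (g2 x - g2 c)
  have hρ : ∀ x ∈ closedBall c h, |ρ x| ≤ C * h ^ τ := by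
    intro x hx
    rw [mem_closedBall] at hx
    refine (hf x (hx.trans hhH)).trans ?_
    gcongr
  have tri : ∀ x ∈ closedBall c h, ∀ y ∈ closedBall c h, ∀ z ∈ closedBall c h,
      |strat ρ g1 g2 x y z| ≤
        C * (H₁ * 2 ^ β₁ * (H₂ * 2 ^ β₂)) * h ^ (τ + (β₁ + β₂)) := by
    intro x hx y hy z hz
    refine (abs_strat_le (hρ x hx) (hρ y hy) (hρ z hz) (k1 hy hx) (k1 hz hx) (k2 hy hx)
      (k2 hz hx)).trans_eq ?_
    rw [Real.rpow_add_of_nonneg hh hτ (by positivity), Real.rpow_add_of_nonneg hh hβ₁ hβ₂]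
    ring
  have t1 := abs_le.1 (tri q hq r hr s hs)
  have t2 := abs_le.1 (tri p hp r hr s hs)
  have t3 := abs_le.1 (tri p hp q hq s hs)
  have t4 := abs_le.1 (tri p hp q hq r hr)
  unfold cob
  rw [abs_le]
  constructor <;> linarith [t1.1, t1.2, t2.1, t2.2]

theorem rpow_le_rpow_sub_mul_rpow {d L a b : ℝ} (hd : 0 ≤ d) (hdL : d ≤ L) (hb : 0 ≤ b)
    (hab : b ≤ a) : d ^ a ≤ L ^ (a - b) * d ^ b := by
  have hab' := sub_nonneg.2 hab
  have e : d ^ a = d ^ (a - b) * d ^ b := by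
    rw [← Real.rpow_add_of_nonneg hd hab' hb, sub_add_cancel]
  rw [e]
  gcongr

/-- First-order Taylor estimate for a function with `γ`-Hölder gradient. -/
theorem abs_sub_sub_inner_gradient_le {G : E2 → ℝ} {K γ : ℝ} (hK : 0 ≤ K) (hγ : 0 ≤ γ)
    (hG : Differentiable ℝ G)
    (hgrad : ∀ x y, ‖gradient G x - gradient G y‖ ≤ K * dist x y ^ γ) (y₀ y : E2) :
    |G y - G y₀ - inner ℝ (gradient G y₀) (y - y₀)| ≤ K * ‖y - y₀‖ ^ (1 + γ) := by
  have hd : ∀ z ∈ closedBall y₀ ‖y - y₀‖, HasFDerivWithinAt G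
      (InnerProductSpace.toDual ℝ E2 (gradient G z)) (closedBall y₀ ‖y - y₀‖) z := fun z _ =>
    ((hG z).hasGradientAt.hasFDerivAt).hasFDerivWithinAt
  have hb : ∀ z ∈ closedBall y₀ ‖y - y₀‖, ‖InnerProductSpace.toDual ℝ E2 (gradient G z) -
      InnerProductSpace.toDual ℝ E2 (gradient G y₀)‖ ≤ K * ‖y - y₀‖ ^ γ := fun z hz => by
    rw [← map_sub, LinearIsometryEquiv.norm_map]
    refine (hgrad z y₀).trans ?_
    rw [mem_closedBall] at hz
    gcongr
  have := (convex_closedBall y₀ ‖y - y₀‖).norm_image_sub_le_of_norm_hasFDerivWithin_le' hd hb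
    (mem_closedBall_self (norm_nonneg _)) (y := y) (by rw [mem_closedBall, dist_eq_norm])
  rw [InnerProductSpace.toDual_apply_apply, Real.norm_eq_abs] at this
  refine this.trans_eq ?_
  rw [Real.rpow_add_of_nonneg (norm_nonneg _) zero_le_one hγ, Real.rpow_one]
  ring

theorem norm_toLp_sub_le (a b c d : ℝ) :
    ‖(WithLp.equiv 2 (Fin 2 → ℝ)).symm ![a, b] - (WithLp.equiv 2 (Fin 2 → ℝ)).symm ![c, d]‖
      ≤ |a - c| + |b - d| := by
  rw [EuclideanSpace.norm_eq, Fin.sum_univ_two]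
  simp only [Real.norm_eq_abs]
  apply Real.sqrt_le_iff.2
  refine ⟨by positivity, ?_⟩
  simp
  nlinarith [abs_nonneg (a - c), abs_nonneg (b - d), sq_abs (a - c), sq_abs (b - d),
    mul_nonneg (abs_nonneg (a - c)) (abs_nonneg (b - d))]

/-- `x ↦ F x (g x)` is controlled by `g`. -/
theorem exists_controlled_expansion {α γ β₁ β₂ : ℝ} (hα : 0 < α) (hγ : 0 < γ) (hβ₁ : 0 < β₁)
    (hβ₂ : 0 < β₂) {g1 g2 : E2 → ℝ} {H₁ H₂ : ℝ} (hH₁ : 0 ≤ H₁) (hH₂ : 0 ≤ H₂)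
    (hg1 : ∀ x y, |g1 x - g1 y| ≤ H₁ * dist x y ^ β₁)
    (hg2 : ∀ x y, |g2 x - g2 y| ≤ H₂ * dist x y ^ β₂)
    {F : E2 → E2 → ℝ} {K : ℝ} (hK : 0 < K) (hFdiff : ∀ u, Differentiable ℝ (F u))
    (hFx : ∀ u v x, |F u x - F v x| ≤ K * dist u v ^ α)
    (hFgrad : ∀ u x y, ‖gradient (F u) x - gradient (F u) y‖ ≤ K * dist x y ^ γ)
    {f : E2 → ℝ} (hf : f = fun x => F x ((WithLp.equiv 2 (Fin 2 → ℝ)).symm ![g1 x, g2 x]))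
    (H : ℝ) :
    ∃ C, 0 ≤ C ∧ ∀ c, ∃ a₁ a₂ : ℝ, ∀ x, dist x c ≤ H →
      |f x - f c - a₁ * (g1 x - g1 c) - a₂ * (g2 x - g2 c)|
        ≤ C * dist x c ^ min α (min β₁ β₂ * (1 + γ)) := by
  set β := min β₁ β₂ with hβdef
  set τ := min α (β * (1 + γ)) with hτdef
  have hβ : 0 < β := lt_min hβ₁ hβ₂
  have hτ : 0 < τ := lt_min hα (by positivity)
  set L := max H 1 with hLdef
  have hL : 0 < L := lt_max_of_lt_right one_pos
  set S := H₁ * L ^ (β₁ - β) + H₂ * L ^ (β₂ - β) with hS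
  have hS0 : 0 ≤ S := by positivity
  refine ⟨K * L ^ (α - τ) + K * (S ^ (1 + γ) * L ^ (β * (1 + γ) - τ)), by positivity, fun c => ?_⟩
  set g : E2 → E2 := fun x => (WithLp.equiv 2 (Fin 2 → ℝ)).symm ![g1 x, g2 x] with hg
  refine ⟨gradient (F c) (g c) 0, gradient (F c) (g c) 1, fun x hx => ?_⟩
  have hd : 0 ≤ dist x c := dist_nonneg
  have hxL : dist x c ≤ L := hx.trans (le_max_left _ _)
  have hgn : ‖g x - g c‖ ≤ S * dist x c ^ β := by
    have e1 := rpow_le_rpow_sub_mul_rpow hd hxL hβ.le (min_le_left β₁ β₂)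
    have e2 := rpow_le_rpow_sub_mul_rpow hd hxL hβ.le (min_le_right β₁ β₂)
    calc ‖g x - g c‖ ≤ |g1 x - g1 c| + |g2 x - g2 c| := norm_toLp_sub_le _ _ _ _
      _ ≤ H₁ * dist x c ^ β₁ + H₂ * dist x c ^ β₂ := add_le_add (hg1 x c) (hg2 x c)
      _ ≤ H₁ * (L ^ (β₁ - β) * dist x c ^ β) + H₂ * (L ^ (β₂ - β) * dist x c ^ β) := by gcongr
      _ = S * dist x c ^ β := by rw [hS]; ring
  have hinner : inner ℝ (gradient (F c) (g c)) (g x - g c) =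
      gradient (F c) (g c) 0 * (g1 x - g1 c) + gradient (F c) (g c) 1 * (g2 x - g2 c) := by
    rw [PiLp.inner_apply, Fin.sum_univ_two]
    simp [hg]
    ring
  have htaylor : |F c (g x) - F c (g c) - inner ℝ (gradient (F c) (g c)) (g x - g c)| ≤
      K * (S ^ (1 + γ) * L ^ (β * (1 + γ) - τ)) * dist x c ^ τ := by
    refine (abs_sub_sub_inner_gradient_le hK.le hγ.le (hFdiff c) (hFgrad c) _ _).trans ?_
    calc K * ‖g x - g c‖ ^ (1 + γ) ≤ K * (S * dist x c ^ β) ^ (1 + γ) := by gcongr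
      _ = K * (S ^ (1 + γ) * dist x c ^ (β * (1 + γ))) := by
        rw [Real.mul_rpow hS0 (by positivity), ← Real.rpow_mul hd]
      _ ≤ K * (S ^ (1 + γ) * (L ^ (β * (1 + γ) - τ) * dist x c ^ τ)) := by
        gcongr
        exact rpow_le_rpow_sub_mul_rpow hd hxL hτ.le (min_le_right _ _)
      _ = K * (S ^ (1 + γ) * L ^ (β * (1 + γ) - τ)) * dist x c ^ τ := by ring
  have hbase : |F x (g x) - F c (g x)| ≤ K * L ^ (α - τ) * dist x c ^ τ := by
    refine (hFx x c (g x)).trans ?_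
    rw [mul_assoc]
    gcongr
    exact rpow_le_rpow_sub_mul_rpow hd hxL hτ.le (min_le_left _ _)
  have e : f x - f c - gradient (F c) (g c) 0 * (g1 x - g1 c)
      - gradient (F c) (g c) 1 * (g2 x - g2 c) = (F x (g x) - F c (g x)) +
        (F c (g x) - F c (g c) - inner ℝ (gradient (F c) (g c)) (g x - g c)) := by
    rw [hinner, hf]
    ring
  rw [e, add_mul]
  exact (abs_add_le _ _).trans (add_le_add hbase htaylor)

theorem tendsto_mul_dist_rpow (K : ℝ) {α : ℝ} (hα : 0 < α) (c : E2) :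
    Tendsto (fun x => K * dist x c ^ α) (nhds c) (nhds 0) := by
  have h : Continuous fun x : E2 => K * dist x c ^ α :=
    continuous_const.mul ((continuous_id.dist continuous_const).rpow_const fun _ => Or.inr hα.le)
  simpa [Real.zero_rpow hα.ne'] using h.tendsto c

theorem continuous_of_abs_sub_le {g : E2 → ℝ} {H β : ℝ} (hβ : 0 < β)
    (hg : ∀ x y, |g x - g y| ≤ H * dist x y ^ β) : Continuous g := by
  refine continuous_iff_continuousAt.2 fun c => ?_
  rw [ContinuousAt, tendsto_iff_dist_tendsto_zero]
  exact squeeze_zero (fun _ => dist_nonneg) (fun x => hg x c) (tendsto_mul_dist_rpow H hβ c)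

theorem continuous_comp_of_abs_sub_le {F : E2 → E2 → ℝ} {g : E2 → E2} {K α : ℝ} (hα : 0 < α)
    (hF : ∀ u, Continuous (F u)) (hFx : ∀ u v x, |F u x - F v x| ≤ K * dist u v ^ α)
    (hg : Continuous g) : Continuous fun x => F x (g x) := by
  refine continuous_iff_continuousAt.2 fun c => ?_
  have h1 : Tendsto (fun x => F x (g x) - F c (g x)) (nhds c) (nhds 0) :=
    squeeze_zero_norm (fun x => hFx x c (g x)) (tendsto_mul_dist_rpow K hα c)
  have h2 : Tendsto (fun x => F c (g x)) (nhds c) (nhds (F c (g c))) :=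
    ((hF c).comp hg).tendsto c
  simpa [ContinuousAt] using h1.add h2

/-- Stratonovich-type integral for `f(x) = F(x, g(x))` under relaxed Hölder
conditions on `g`. -/
theorem stmt_15 (α γ β₁ β₂ : ℝ) (hα : α ∈ Set.Ioc (0:ℝ) 1) (hγ : γ ∈ Set.Ioc (0:ℝ) 1)
    (hβ₁ : β₁ ∈ Set.Ioc (0:ℝ) 1) (hβ₂ : β₂ ∈ Set.Ioc (0:ℝ) 1)
    (hsum1 : 1 < β₁ + β₂) (hsum2 : 2 < α + β₁ + β₂)
    (hsum3 : 2 < (1 + γ) * β₁ + β₁ + β₂) (hsum4 : 2 < (1 + γ) * β₂ + β₁ + β₂)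
    (g1 g2 : E2 → ℝ) (H1 H2 : ℝ) (hH10 : 0 ≤ H1) (hH20 : 0 ≤ H2)
    (hg1 : ∀ x y, |g1 x - g1 y| ≤ H1 * dist x y ^ β₁)
    (hg2 : ∀ x y, |g2 x - g2 y| ≤ H2 * dist x y ^ β₂)
    (F : E2 → E2 → ℝ) (M K : ℝ) (hK : 0 < K)
    (hFb : ∀ u x, |F u x| ≤ M)
    (hFdiff : ∀ u, Differentiable ℝ (F u))
    (hFx : ∀ u v x, |F u x - F v x| ≤ K * dist u v ^ α)
    (hFgrad : ∀ u x y, ‖gradient (F u) x - gradient (F u) y‖ ≤ K * dist x y ^ γ)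
    (hFgradb : ∀ u x, ‖gradient (F u) x‖ ≤ K) :
    ∃ V : E2 → E2 → E2 → ℝ,
      (∀ p q r, Tendsto
        (fun n => dyaSum
          (strat (fun x => F x ((WithLp.equiv 2 (Fin 2 → ℝ)).symm ![g1 x, g2 x])) g1 g2)
          n p q r) atTop (nhds (V p q r))) ∧
      Alternating2 V ∧
      Continuous (fun x : E2 × E2 × E2 => V x.1 x.2.1 x.2.2) ∧
      (∀ p q r : E2,
        (q 0 - p 0) * (r 1 - p 1) - (q 1 - p 1) * (r 0 - p 0) = 0 → V p q r = 0) := by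
  set f : E2 → ℝ := fun x => F x ((WithLp.equiv 2 (Fin 2 → ℝ)).symm ![g1 x, g2 x]) with hf
  have cg1 := continuous_of_abs_sub_le hβ₁.1 hg1
  have cg2 := continuous_of_abs_sub_le hβ₂.1 hg2
  have cf : Continuous f := by
    refine continuous_comp_of_abs_sub_le hα.1 (fun u => (hFdiff u).continuous) hFx ?_
    refine (PiLp.continuous_toLp 2 _).comp (continuous_pi fun i => ?_)
    fin_cases i
    · exact cg1
    · exact cg2
  have hcont : Continuous fun x : E2 × E2 × E2 => strat f g1 g2 x.1 x.2.1 x.2.2 := by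
    unfold strat
    fun_prop
  have hτ : 0 < min α (min β₁ β₂ * (1 + γ)) :=
    lt_min hα.1 (mul_pos (lt_min hβ₁.1 hβ₂.1) (by linarith [hγ.1]))
  have hθ : 2 < min α (min β₁ β₂ * (1 + γ)) + (β₁ + β₂) := by
    rcases min_choice α (min β₁ β₂ * (1 + γ)) with h | h <;> rw [h]
    · linarith
    · rcases min_choice β₁ β₂ with h' | h' <;> rw [h'] <;> linarith
  have hω := isAlt_strat f g1 g2
  have ho : HasOrder (strat f g1 g2) (β₁ + β₂) :=
    hasOrder_strat hβ₁.1.le hβ₂.1.le hH10 hH20 (fun x => hFb _ _) hg1 hg2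
  have hc := hasCobOrder_strat hβ₁.1.le hβ₂.1.le hτ.le hH10 hH20 hg1 hg2
    (exists_controlled_expansion hα.1 hγ.1 hβ₁.1 hβ₂.1 hH10 hH20 hg1 hg2 hK hFdiff hFx hFgrad hf)
  obtain ⟨V, hV, hVc⟩ := exists_tendsto_dyaSum hω hsum1 hθ ho hc hcont
  refine ⟨V, hV, IsAlt.alternating2 ⟨fun p q r => ?_, fun p q r => ?_⟩, hVc, fun p q r h => ?_⟩
  · exact tendsto_nhds_unique (hV q p r)
      ((hV p q r).neg.congr fun n => ((hω.dyaSum n).swap_left p q r).symm)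
  · exact tendsto_nhds_unique (hV p r q)
      ((hV p q r).neg.congr fun n => ((hω.dyaSum n).swap_right p q r).symm)
  · obtain ⟨v, hv, a, b, hq, hr⟩ := exists_line_of_collinear h
    refine tendsto_nhds_unique (hV p q r) (tendsto_dyaSum_zero hω hsum1 hθ ho hc
      (A := Set.range fun t : ℝ => p + t • v) ?_ (fun h hh => exists_rounding_line p v hv hh)
      ⟨0, by simp⟩ ⟨a, hq.symm⟩ ⟨b, hr.symm⟩)
    rintro _ ⟨s, rfl⟩ _ ⟨t, rfl⟩
    refine ⟨(s + t) / 2, ?_⟩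
    simp only [midpoint_eq_smul_add, invOf_eq_inv]
    module
end
end
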